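/- Fix ε ∈ (0,1]. Then lim_{M→∞} limsup_{x→∞} ∑_{m > M} a_m(x) = 0, where for each x the sum over m > M has only finitely many nonzero terms. -/

import Mathlib

open Finset Filter

noncomputable section

/-- `S ℓ p = ∑_{n ≤ ℓ} (n/p)`, the quadratic character sum (Legendre symbol for odd prime `p`). -/
def S (ℓ p : ℕ) : ℤ := ∑ n ∈ Finset.Icc 1 ℓ, jacobiSym (n : ℤ) p

/-- the first-passage time `f_ε(p) = min {ℓ ≥ 1 : S_ℓ(p) < ε ℓ}`. -/
def fpt (ε : ℝ) (p : ℕ) : ℕ := sInf {ℓ : ℕ | 1 ≤ ℓ ∧ ((S ℓ p : ℝ)) < ε * ℓ}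

/-- the odd primes up to a real number `x`. -/
def oddPrimesUpTo (x : ℝ) : Finset ℕ :=
  (Finset.range (⌊x⌋₊ + 1)).filter (fun p => p.Prime ∧ p ≠ 2)

/-- `π_odd(x)`, the number of odd primes up to `x`. -/
def piOdd (x : ℝ) : ℕ := (oddPrimesUpTo x).card

/-- `P_ℓ(x)`, the density of odd primes `p ≤ x` with `S_ℓ(p) ≥ ε ℓ`. -/
def Pdens (ε : ℝ) (ℓ : ℕ) (x : ℝ) : ℝ :=
  (((oddPrimesUpTo x).filter (fun p => ε * ℓ ≤ (S ℓ p : ℝ))).card : ℝ) / (piOdd x : ℝ)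

/-- `a_m(x) = N_m(x)/π_odd(x)`, the proportion of odd primes `p ≤ x` with `f_ε(p) > m`. -/
def aCoef (ε : ℝ) (m : ℕ) (x : ℝ) : ℝ :=
  (((oddPrimesUpTo x).filter (fun p => m < fpt ε p)).card : ℝ) / (piOdd x : ℝ)

/-- `c_u(ℓ)`, the number of triples `(a,b,c) ∈ {1,…,ℓ}³` with `abc = u`. -/
def cCoef (ℓ u : ℕ) : ℕ :=
  ((Finset.Icc 1 ℓ ×ˢ Finset.Icc 1 ℓ ×ˢ Finset.Icc 1 ℓ).filter
    (fun t => t.1 * t.2.1 * t.2.2 = u)).card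

/-- `C_3(ℓ) = ∑_{u,v ≤ ℓ³, uv = □} c_u(ℓ) c_v(ℓ)`. -/
def C3 (ℓ : ℕ) : ℕ :=
  ∑ q ∈ (Finset.Icc 1 (ℓ ^ 3) ×ˢ Finset.Icc 1 (ℓ ^ 3)).filter (fun q => IsSquare (q.1 * q.2)),
    cCoef ℓ q.1 * cCoef ℓ q.2


lemma divisor_bound (δ : ℝ) (hδ : 0 < δ) :
    ∃ C : ℝ, 0 < C ∧ ∀ n : ℕ, n ≠ 0 → (n.divisors.card : ℝ) ≤ C * (n : ℝ) ^ δ := by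
  set a : ℝ := 2 ^ δ - 1 with ha
  have ha0 : 0 < a := by
    have := Real.one_lt_rpow (x := 2) (by norm_num) hδ
    linarith
  set K : ℝ := max 1 (1 / a) with hK
  have hK1 : 1 ≤ K := le_max_left _ _
  have hKa : 1 ≤ K * a := by
    have : 1 / a ≤ K := le_max_right _ _
    calc (1:ℝ) = 1 / a * a := by field_simp
      _ ≤ K * a := by gcongr
  obtain ⟨B, hB⟩ := exists_nat_gt ((2:ℝ) ^ (1 / δ))
  have key : ∀ p e : ℕ, 2 ≤ p → ((e : ℝ) + 1) ≤ (if p < B then K else 1) * ((p : ℝ) ^ δ) ^ e := by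
    intro p e hp
    split_ifs with h
    · have h1 : (1 + a) ≤ (p : ℝ) ^ δ := by
        rw [ha]; ring_nf
        exact Real.rpow_le_rpow (by norm_num) (by exact_mod_cast hp) hδ.le
      have h2 : 1 + (e : ℝ) * a ≤ (1 + a) ^ e := one_add_mul_le_pow (by linarith) e
      have h3 : (1 + a) ^ e ≤ ((p : ℝ) ^ δ) ^ e := pow_le_pow_left₀ (by linarith) h1 e
      have he : (0:ℝ) ≤ e := Nat.cast_nonneg _
      nlinarith
    · push Not at h
      have h1 : (1 + 1 : ℝ) ≤ (p : ℝ) ^ δ := by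
        have : (2:ℝ) ^ (1 / δ) ≤ p := hB.le.trans (by exact_mod_cast h)
        have := Real.rpow_le_rpow (by positivity) this hδ.le
        rw [← Real.rpow_mul (by norm_num)] at this
        rw [one_div_mul_cancel hδ.ne', Real.rpow_one] at this
        linarith
      have h2 : 1 + (e : ℝ) * 1 ≤ (1 + 1) ^ e := one_add_mul_le_pow (by linarith) e
      have h3 : (1 + 1 : ℝ) ^ e ≤ ((p : ℝ) ^ δ) ^ e := pow_le_pow_left₀ (by linarith) h1 e
      linarith
  refine ⟨K ^ B, by positivity, ?_⟩
  intro n hn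
  rw [Nat.card_divisors hn]
  push_cast
  have h1 : (n : ℝ) ^ δ = ∏ p ∈ n.primeFactors, ((p : ℝ) ^ δ) ^ (n.factorization p) := by
    conv_lhs => rw [← Nat.prod_factorization_pow_eq_self hn]
    rw [Finsupp.prod, Nat.support_factorization]
    push_cast
    rw [← Real.finsetProd_rpow _ _ (fun i _ => by positivity)]
    refine Finset.prod_congr rfl fun p _ => ?_
    rw [← Real.rpow_natCast, ← Real.rpow_natCast, ← Real.rpow_mul (by positivity),
      ← Real.rpow_mul (by positivity), mul_comm]
  have h2 : ∏ p ∈ n.primeFactors, ((n.factorization p : ℝ) + 1) ≤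
      ∏ p ∈ n.primeFactors, ((if p < B then K else 1) * ((p : ℝ) ^ δ) ^ (n.factorization p)) := by
    refine Finset.prod_le_prod (fun p _ => by positivity) fun p hp => ?_
    exact key p _ (Nat.prime_of_mem_primeFactors hp).two_le
  rw [Finset.prod_mul_distrib, ← h1] at h2
  refine h2.trans ?_
  gcongr
  rw [Finset.prod_ite, Finset.prod_const, Finset.prod_const, one_pow, mul_one]
  refine pow_le_pow_right₀ hK1 ?_
  calc _ ≤ (Finset.range B).card := Finset.card_le_card (by intro p; simp)
    _ = B := Finset.card_range B

lemma tuple_count (k m n : ℕ) (hn : n ≠ 0) :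
    ((Fintype.piFinset (fun _ : Fin k => Icc 1 m)).filter (fun t => ∏ i, t i = n)).card
      ≤ n.divisors.card ^ k := by
  calc _ ≤ (Fintype.piFinset (fun _ : Fin k => n.divisors)).card := by
        refine Finset.card_le_card fun t ht => ?_
        simp only [Finset.mem_filter, Fintype.mem_piFinset] at ht
        simp only [Fintype.mem_piFinset, Nat.mem_divisors]
        intro i
        exact ⟨ht.2 ▸ Finset.dvd_prod_of_mem t (Finset.mem_univ i), hn⟩
    _ = _ := by simp

lemma per_zero (F : ℕ → ℤ) (Q b : ℕ) (hQ : 0 < Q) (hper : ∀ n, F (n % Q) = F n)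
    (hmul : ∀ a b, F (a * b) = F a * F b) (hb : Nat.Coprime b Q) (hFb : F b = -1) :
    ∑ n ∈ range Q, F n = 0 := by
  have h : ∑ n ∈ range Q, F (b * n) = ∑ n ∈ range Q, F n := by
    have hinj : Set.InjOn (fun n => b * n % Q) (range Q : Finset ℕ) := by
      intro x hx y hy hxy
      have h1 : b * x ≡ b * y [MOD Q] := hxy
      have h2 := Nat.ModEq.cancel_left_of_coprime (by rwa [Nat.coprime_comm] at hb) h1
      simp at hx hy
      exact Nat.ModEq.eq_of_lt_of_lt h2 hx hy
    have himg : (range Q).image (fun n => b * n % Q) = range Q := by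
      apply Finset.eq_of_subset_of_card_le
      · intro y hy
        simp at hy
        obtain ⟨x, _, rfl⟩ := hy
        simpa using Nat.mod_lt _ hQ
      · rw [Finset.card_image_of_injOn hinj]
    conv_rhs => rw [← himg]
    rw [Finset.sum_image hinj]
    exact Finset.sum_congr rfl fun n _ => (hper _).symm
  simp only [hmul, hFb, ← Finset.mul_sum] at h
  linarith

lemma per_bound (F : ℕ → ℤ) (Q b : ℕ) (hQ : 0 < Q) (hper : ∀ n, F (n % Q) = F n)
    (hmul : ∀ a b, F (a * b) = F a * F b) (hb : Nat.Coprime b Q) (hFb : F b = -1)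
    (h1 : ∀ n, |F n| ≤ 1) (y : ℕ) :
    |∑ n ∈ range y, F n| ≤ Q := by
  have h0 := per_zero F Q b hQ hper hmul hb hFb
  have hadd : ∀ y, ∑ n ∈ range (Q + y), F n = ∑ n ∈ range y, F n := by
    intro y
    rw [Finset.sum_range_add, h0, zero_add]
    refine Finset.sum_congr rfl fun n _ => ?_
    rw [← hper (Q + n), Nat.add_mod_left, hper]
  induction y using Nat.strong_induction_on with
  | _ y ih =>
    by_cases hy : y ≤ Q
    · calc _ ≤ ∑ n ∈ range y, |F n| := Finset.abs_sum_le_sum_abs _ _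
        _ ≤ ∑ n ∈ range y, 1 := Finset.sum_le_sum fun n _ => h1 n
        _ ≤ Q := by simpa using hy
    · have : y = Q + (y - Q) := by omega
      rw [this, hadd]
      exact ih _ (by omega)

lemma exists_nonres (q : ℕ) (hq : q.Prime) (hq2 : q ≠ 2) : ∃ r : ℕ, jacobiSym (r : ℤ) q = -1 := by
  have := Fact.mk hq
  obtain ⟨a, ha⟩ := quadraticChar_exists_neg_one (F := ZMod q) (by rw [ZMod.ringChar_zmod_n]; exact hq2)
  refine ⟨a.val, ?_⟩
  rw [← jacobiSym.legendreSym.to_jacobiSym, legendreSym]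
  simpa using ha

lemma nonsq_aux (q c s : ℕ) (hq : q.Prime) (hqc : ¬ q ∣ c) (hc : c ≠ 0) (hs : s ≠ 0) :
    ∃ b : ℕ, Odd b ∧ b.Coprime (4 * (s ^ 2 * (q * c))) ∧
      jacobiSym ((s ^ 2 * (q * c) : ℕ) : ℤ) b = -1 := by
  obtain ⟨f, s', hs', rfl⟩ := Nat.exists_eq_pow_mul_and_not_dvd hs q hq.ne_one
  have hs'0 : s' ≠ 0 := by rintro rfl; simp at hs'
  -- it is enough to find b
  suffices H : ∃ b : ℕ, Odd b ∧ b.Coprime q ∧ b.Coprime s' ∧ b.Coprime c ∧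
      jacobiSym (q : ℤ) b = -1 ∧ jacobiSym (c : ℤ) b = 1 by
    obtain ⟨b, hbo, hbq, hbs, hbc, h1, h2⟩ := H
    have hbn : b.Coprime ((q ^ f * s') ^ 2 * (q * c)) :=
      Nat.Coprime.mul_right (Nat.Coprime.pow_right _ (Nat.Coprime.mul_right (hbq.pow_right _) hbs))
        (Nat.Coprime.mul_right hbq hbc)
    refine ⟨b, hbo, Nat.Coprime.mul_right ?_ hbn, ?_⟩
    · have : b.Coprime (2 ^ 2) := Nat.Coprime.pow_right _ (Nat.coprime_two_right.2 hbo)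
      simpa using this
    · push_cast
      rw [jacobiSym.mul_left, jacobiSym.mul_left, h1, h2]
      have : jacobiSym ((((q : ℤ) ^ f * s') ^ 2)) b = 1 := by
        apply jacobiSym.sq_one'
        have h3 : (q ^ f * s').Coprime b :=
          (Nat.Coprime.mul_right (hbq.pow_right _) hbs).symm
        have : Int.gcd (((q ^ f * s' : ℕ) : ℤ)) b = 1 := by
          rw [Int.gcd_natCast_natCast]; exact h3
        simpa using this
      rw [this]; norm_num
  have hqs : q.Coprime s' := (Nat.Prime.coprime_iff_not_dvd hq).2 hs'
  have hqc' : q.Coprime c := (Nat.Prime.coprime_iff_not_dvd hq).2 hqc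
  by_cases hq2 : q = 2
  · subst hq2
    have hco : Nat.Coprime 8 (s' * c) := by
      have : Nat.Coprime (2 ^ 3) (s' * c) := Nat.Coprime.pow_left _ (Nat.Coprime.mul_right hqs hqc')
      simpa using this
    obtain ⟨b, hb1, hb2⟩ := Nat.chineseRemainder hco 5 1
    have hb8 : b % 8 = 5 := hb1
    have hbo : Odd b := by rw [Nat.odd_iff]; omega
    have hbsc : b.Coprime (s' * c) := by
      have := Nat.ModEq.gcd_eq hb2
      simpa [Nat.Coprime] using this
    refine ⟨b, hbo, Nat.coprime_two_right.2 hbo, Nat.Coprime.coprime_mul_right_right hbsc,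
      Nat.Coprime.coprime_mul_left_right hbsc, ?_, ?_⟩
    · have := jacobiSym.at_two hbo
      push_cast
      rw [this, ZMod.χ₈_nat_mod_eight, hb8]
      decide
    · have hco2 : Odd c := by rw [Nat.odd_iff]; omega
      rw [jacobiSym.quadratic_reciprocity_one_mod_four' hco2 (by omega)]
      have : (b : ℤ) % c = 1 % c := by
        have : b ≡ 1 [MOD c] := Nat.ModEq.of_mul_left _ hb2
        exact_mod_cast this
      rw [jacobiSym.mod_left' this, jacobiSym.one_left]
  · obtain ⟨r, hr⟩ := exists_nonres q hq hq2
    have hq4 : q.Coprime 4 := by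
      have : q.Coprime (2 ^ 2) := Nat.Coprime.pow_right _
        ((Nat.coprime_primes hq Nat.prime_two).2 hq2)
      simpa using this
    have hqo : Odd q := hq.odd_of_ne_two hq2
    have hco : q.Coprime (4 * c * s') := Nat.Coprime.mul_right (Nat.Coprime.mul_right hq4 hqc') hqs
    obtain ⟨b, hb1, hb2⟩ := Nat.chineseRemainder hco r 1
    have hb4c : b ≡ 1 [MOD 4 * c] := Nat.ModEq.of_mul_right _ hb2
    have hb4 : b % 4 = 1 := Nat.ModEq.of_mul_right _ hb4c
    have hbo : Odd b := by rw [Nat.odd_iff]; omega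
    have hbsc : b.Coprime (4 * c * s') := by
      have := Nat.ModEq.gcd_eq hb2
      simpa [Nat.Coprime] using this
    have hJ : jacobiSym (q : ℤ) b = -1 := by
      rw [jacobiSym.quadratic_reciprocity_one_mod_four' hqo hb4]
      have : (b : ℤ) % q = r % q := by exact_mod_cast hb1
      rw [jacobiSym.mod_left' this, hr]
    refine ⟨b, hbo, ?_, Nat.Coprime.coprime_mul_left_right hbsc,
      Nat.Coprime.coprime_mul_left_right (Nat.Coprime.coprime_mul_right_right hbsc), hJ, ?_⟩
    · have hb0 : b ≠ 0 := by rintro rfl; simp at hb4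
      have : NeZero b := ⟨hb0⟩
      by_contra hcon
      have : jacobiSym (q : ℤ) b = 0 := jacobiSym.eq_zero_iff_not_coprime.2 (by
        rw [Int.gcd_natCast_natCast]; rwa [Nat.coprime_comm] at hcon)
      omega
    · rw [jacobiSym.mod_right' c hbo]
      have : b % (4 * c) = 1 := by
        have h := hb4c
        unfold Nat.ModEq at h
        rw [h]; apply Nat.mod_eq_of_lt; omega
      rw [this, jacobiSym.one_right]

lemma nonsq_exists (n : ℕ) (hn : n ≠ 0) (hsq : ¬ IsSquare n) :
    ∃ b : ℕ, Odd b ∧ b.Coprime (4 * n) ∧ jacobiSym (n : ℤ) b = -1 := by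
  obtain ⟨a, s, hsa, ha⟩ := Nat.sq_mul_squarefree n
  have ha1 : a ≠ 1 := by
    rintro rfl
    exact hsq ⟨s, by rw [← hsa]; ring⟩
  obtain ⟨q, hq, c, rfl⟩ := Nat.exists_prime_and_dvd ha1
  have hs : s ≠ 0 := by rintro rfl; simp at hsa; exact hn hsa.symm
  have hc : c ≠ 0 := by rintro rfl; simp at hsa; exact hn hsa.symm
  have hqc : ¬ q ∣ c := by
    rintro ⟨d, rfl⟩
    have := ha q ⟨d, by ring⟩
    exact hq.one_lt.ne' (Nat.isUnit_iff.1 this)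
  have := nonsq_aux q c s hq hqc hc hs
  rwa [hsa] at this

/-- Jacobi symbol in the lower variable, extended by zero. -/
def JF (n d : ℕ) : ℤ := if Odd d then jacobiSym (n : ℤ) d else 0

lemma jac_abs_le (a : ℤ) (b : ℕ) : |jacobiSym a b| ≤ 1 := by
  rcases jacobiSym.trichotomy a b with h | h | h <;> simp [h]

lemma JF_abs_le (n d : ℕ) : |JF n d| ≤ 1 := by
  unfold JF
  split_ifs
  · exact jac_abs_le _ _
  · simp

lemma JF_mul (n a b : ℕ) : JF n (a * b) = JF n a * JF n b := by
  unfold JF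
  by_cases ha : Odd a <;> by_cases hb : Odd b <;> simp [ha, hb, Nat.odd_mul]
  rw [jacobiSym.mul_right' _ (Nat.ne_of_odd_add (by simpa using ha))
    (Nat.ne_of_odd_add (by simpa using hb))]

lemma JF_sum (n : ℕ) (hn : n ≠ 0) (hsq : ¬ IsSquare n) (y : ℕ) :
    |∑ d ∈ range y, JF n d| ≤ 4 * n := by
  obtain ⟨b, hbo, hb, hJ⟩ := nonsq_exists n hn hsq
  have := per_bound (JF n) (4 * n) b (by omega) ?_ (JF_mul n) hb (by simp [JF, hbo, hJ])
    (JF_abs_le n) y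
  · exact_mod_cast this
  · intro d
    have hpar : Odd (d % (4 * n)) ↔ Odd d := by
      rw [Nat.odd_iff, Nat.odd_iff, Nat.mod_mod_of_dvd d (Dvd.intro (2 * n) (by ring))]
    unfold JF
    by_cases hd : Odd d
    · simp [hpar, hd, jacobiSym.mod_right' n hd]
    · simp [hpar, hd]

lemma pq_sum (p q : ℕ) (hp : p.Prime) (hq : q.Prime) (hp2 : p ≠ 2) (hpq : p ≠ q)
    (y : ℕ) :
    |∑ n ∈ range y, jacobiSym (n : ℤ) p * jacobiSym (n : ℤ) q| ≤ p * q := by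
  obtain ⟨r, hr⟩ := exists_nonres p hp hp2
  have hco : p.Coprime q := (Nat.coprime_primes hp hq).2 hpq
  obtain ⟨b, hb1, hb2⟩ := Nat.chineseRemainder hco r 1
  have hbp : jacobiSym (b : ℤ) p = -1 := by
    have : (b : ℤ) % p = r % p := by exact_mod_cast hb1
    rw [jacobiSym.mod_left' this, hr]
  have hbq : jacobiSym (b : ℤ) q = 1 := by
    have : (b : ℤ) % q = 1 % q := by exact_mod_cast hb2
    rw [jacobiSym.mod_left' this, jacobiSym.one_left]
  have hcop : ∀ s : ℕ, s.Prime → jacobiSym (b : ℤ) s ≠ 0 → b.Coprime s := by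
    intro s hs h
    have : NeZero s := ⟨hs.ne_zero⟩
    by_contra hcon
    exact h (jacobiSym.eq_zero_iff_not_coprime.2 (by rwa [Int.gcd_natCast_natCast]))
  have := per_bound (fun n => jacobiSym (n : ℤ) p * jacobiSym (n : ℤ) q) (p * q) b
    (Nat.mul_pos hp.pos hq.pos) ?_ ?_
    (Nat.Coprime.mul_right (hcop p hp (by rw [hbp]; norm_num)) (hcop q hq (by rw [hbq]; norm_num)))
    (by simp [hbp, hbq]) ?_ y
  · exact_mod_cast this
  · intro n
    congr 1
    · apply jacobiSym.mod_left'
      push_cast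
      exact Int.emod_emod_of_dvd _ (Dvd.intro _ rfl)
    · apply jacobiSym.mod_left'
      push_cast
      exact Int.emod_emod_of_dvd _ (Dvd.intro_left _ rfl)
  · intro a b
    push_cast
    rw [jacobiSym.mul_left, jacobiSym.mul_left]; ring
  · intro n
    simp only [abs_mul]
    exact mul_le_one₀ (jac_abs_le _ _) (abs_nonneg _) (jac_abs_le _ _)

open ArithmeticFunction in
lemma mu_sum (n k : ℕ) (hn : n ≠ 0) (hk : Squarefree k) :
    ∑ e ∈ k.divisors.filter (fun e => n ∣ e), (moebius e : ℤ) = if n = k then moebius n else 0 := by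
  by_cases hnk : n ∣ k
  · obtain ⟨c, rfl⟩ := hnk
    have hco : n.Coprime c := Nat.coprime_of_squarefree_mul hk
    have hc0 : c ≠ 0 := by rintro rfl; simp at hk
    have h1 : (n * c).divisors.filter (fun e => n ∣ e) = c.divisors.image (fun d => n * d) := by
      ext e
      simp only [mem_filter, Nat.mem_divisors, mem_image]
      constructor
      · rintro ⟨⟨h1, h2⟩, ⟨d, rfl⟩⟩
        exact ⟨d, ⟨Nat.dvd_of_mul_dvd_mul_left (Nat.pos_of_ne_zero hn) h1, hc0⟩, rfl⟩
      · rintro ⟨d, ⟨h1, h2⟩, rfl⟩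
        exact ⟨⟨Nat.mul_dvd_mul_left n h1, mul_ne_zero hn hc0⟩, Dvd.intro _ rfl⟩
    rw [h1, Finset.sum_image (fun a _ b _ h => Nat.eq_of_mul_eq_mul_left (Nat.pos_of_ne_zero hn) h)]
    have h2 : ∀ d ∈ c.divisors, moebius (n * d) = moebius n * moebius d := by
      intro d hd
      exact isMultiplicative_moebius.map_mul_of_coprime
        (hco.coprime_dvd_right (Nat.dvd_of_mem_divisors hd))
    rw [Finset.sum_congr rfl h2, ← Finset.mul_sum, ← coe_mul_zeta_apply, moebius_mul_coe_zeta, one_apply]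
    by_cases hc : c = 1
    · simp [hc]
    · have : n ≠ n * c := by
        intro h
        exact hc (Nat.eq_of_mul_eq_mul_left (Nat.pos_of_ne_zero hn) (by rw [← h, mul_one]))
      simp [hc]
      intro h
      simp [hn] at h
      exact absurd h hc
  · rw [if_neg (by rintro rfl; exact hnk dvd_rfl)]
    apply Finset.sum_eq_zero
    intro e he
    simp only [mem_filter, Nat.mem_divisors] at he
    exact absurd (he.2.trans he.1.1) hnk

/-- weights -/
def sg (n : ℕ) : ℝ := if Squarefree n then 1 / (n.totient : ℝ) else 0

def sL (z : ℕ) : ℝ := ∑ n ∈ Icc 1 z, sg n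

def slam (z e : ℕ) : ℝ :=
  (ArithmeticFunction.moebius e : ℝ) * e / sL z * ∑ n ∈ Icc 1 z with e ∣ n, sg n

lemma sg_nonneg (n : ℕ) : 0 ≤ sg n := by unfold sg; split_ifs <;> positivity

lemma inv_sq_sum (z : ℕ) : ∑ b ∈ Icc 1 (z + 1), 1 / (b : ℝ) ^ 2 ≤ 2 - 1 / ((z : ℝ) + 1) := by
  induction z with
  | zero => norm_num
  | succ z ih =>
    rw [Finset.sum_Icc_succ_top (by omega)]
    have h : 1 / ((z + 1 + 1 : ℕ) : ℝ) ^ 2 ≤ 1 / ((z:ℝ) + 1) - 1 / ((z:ℝ) + 1 + 1) := by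
      push_cast
      rw [div_sub_div _ _ (by positivity) (by positivity),
        div_le_div_iff₀ (by positivity) (by positivity)]
      nlinarith [Nat.cast_nonneg (α := ℝ) z]
    push_cast at *
    linarith

lemma sL_ge (z : ℕ) (hz : 1 ≤ z) : Real.log z ≤ 2 * sL z := by
  have h1 : Real.log z ≤ ∑ n ∈ Icc 1 z, 1 / (n : ℝ) := by
    have := log_add_one_le_harmonic z
    rw [harmonic_eq_sum_Icc] at this
    push_cast at this
    have h2 : Real.log z ≤ Real.log (z + 1) :=
      Real.log_le_log (by exact_mod_cast hz) (by linarith)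
    simp only [one_div]
    linarith
  have h2 : ∑ n ∈ Icc 1 z, 1 / (n : ℝ) ≤
      ∑ q ∈ (Icc 1 z) ×ˢ (Icc 1 z), sg q.1 * (1 / (q.2 : ℝ) ^ 2) := by
    have : ∀ n : ℕ, ∃ q : ℕ × ℕ, q.2 ^ 2 * q.1 = n ∧ Squarefree q.1 := by
      intro n
      obtain ⟨a, b, h⟩ := Nat.sq_mul_squarefree n
      exact ⟨(a, b), h⟩
    choose q hq hqs using this
    have hinj : Set.InjOn q (Icc 1 z : Finset ℕ) := by
      intro a _ b _ h
      rw [← hq a, ← hq b, h]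
    have hsub : (Icc 1 z).image q ⊆ (Icc 1 z) ×ˢ (Icc 1 z) := by
      intro r hr
      simp only [mem_image, mem_Icc] at hr
      obtain ⟨n, ⟨hn1, hn2⟩, rfl⟩ := hr
      have h := hq n
      have ha : (q n).1 ≠ 0 := by intro h0; rw [h0] at h; simp at h; omega
      have hb : (q n).2 ≠ 0 := by intro h0; rw [h0] at h; simp at h; omega
      have ha' : (q n).1 ≤ n := Nat.le_of_dvd (by omega) (Dvd.intro_left _ h)
      have hb' : (q n).2 ≤ n := Nat.le_of_dvd (by omega) ⟨(q n).2 * (q n).1, by rw [← mul_assoc, ← sq, h]⟩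
      simp only [mem_product, mem_Icc]
      omega
    calc ∑ n ∈ Icc 1 z, 1 / (n : ℝ) ≤ ∑ n ∈ Icc 1 z, sg (q n).1 * (1 / ((q n).2 : ℝ) ^ 2) := by
          refine Finset.sum_le_sum fun n hn => ?_
          rw [mem_Icc] at hn
          have h := hq n
          have ha : 0 < (q n).1 := by
            apply Nat.pos_of_ne_zero; intro h0; rw [h0] at h; simp at h; omega
          have hb : 0 < (q n).2 := by
            apply Nat.pos_of_ne_zero; intro h0; rw [h0] at h; simp at h; omega
          have hφ : 0 < (q n).1.totient := Nat.totient_pos.2 ha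
          have hφ' : ((q n).1.totient : ℝ) ≤ (q n).1 := by exact_mod_cast Nat.totient_le _
          rw [sg, if_pos (hqs n)]
          have hn' : (n : ℝ) = ((q n).2 : ℝ) ^ 2 * (q n).1 := by exact_mod_cast h.symm
          rw [hn', one_div_mul_one_div, mul_comm]
          gcongr
      _ = ∑ r ∈ (Icc 1 z).image q, sg r.1 * (1 / (r.2 : ℝ) ^ 2) := by
          rw [Finset.sum_image hinj]
      _ ≤ _ := Finset.sum_le_sum_of_subset_of_nonneg hsub fun r _ _ =>
          mul_nonneg (sg_nonneg _) (by positivity)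
  rw [Finset.sum_product] at h2
  simp only [← Finset.mul_sum, ← Finset.sum_mul] at h2
  obtain ⟨z', rfl⟩ : ∃ z', z = z' + 1 := ⟨z - 1, by omega⟩
  have h3 := inv_sq_sum z'
  have h4 : (0:ℝ) < 1 / ((z' : ℝ) + 1) := by positivity
  have h5 : 0 ≤ sL (z' + 1) := Finset.sum_nonneg fun n _ => sg_nonneg n
  change _ ≤ sL (z' + 1) * _ at h2
  nlinarith

lemma sL_pos (z : ℕ) (hz : 1 ≤ z) : 0 < sL z := by
  have : sg 1 ≤ sL z := Finset.single_le_sum (f := sg) (fun n _ => sg_nonneg n) (by simp [hz])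
  simp [sg] at this
  linarith

lemma slam_one (z : ℕ) (hz : 1 ≤ z) : slam z 1 = 1 := by
  have := sL_pos z hz
  simp [slam]
  change (sL z)⁻¹ * sL z = 1
  field_simp

lemma slam_abs (z e : ℕ) (hz : 1 ≤ z) : |slam z e| ≤ e := by
  have hL := sL_pos z hz
  have h1 : ∑ n ∈ Icc 1 z with e ∣ n, sg n ≤ sL z :=
    Finset.sum_le_sum_of_subset_of_nonneg (Finset.filter_subset _ _) fun n _ _ => sg_nonneg n
  have h0 : 0 ≤ ∑ n ∈ Icc 1 z with e ∣ n, sg n := Finset.sum_nonneg fun n _ => sg_nonneg n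
  have hmu : |(ArithmeticFunction.moebius e : ℝ)| ≤ 1 := by
    exact_mod_cast ArithmeticFunction.abs_moebius_le_one
  rw [slam, abs_mul, abs_div, abs_mul, abs_of_pos hL, abs_of_nonneg h0, Nat.abs_cast]
  calc _ ≤ 1 * (e : ℝ) / sL z * sL z := by gcongr
    _ = e := by field_simp

lemma slam_inner (z n : ℕ) (hn : n ∈ Icc 1 z) :
    ∑ e ∈ Icc 1 z with n ∣ e, slam z e / e = (ArithmeticFunction.moebius n : ℝ) * sg n / sL z := by
  rw [mem_Icc] at hn
  have h1 : ∀ e ∈ (Icc 1 z).filter (fun e => n ∣ e), slam z e / e =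
      ∑ k ∈ Icc 1 z, if e ∣ k then (ArithmeticFunction.moebius e : ℝ) / sL z * sg k else 0 := by
    intro e he
    simp only [mem_filter, mem_Icc] at he
    have : (e : ℝ) ≠ 0 := by have := he.1.1; positivity
    rw [← Finset.sum_filter, ← Finset.mul_sum, slam]
    field_simp
  rw [Finset.sum_congr rfl h1, Finset.sum_comm]
  have h2 : ∀ k ∈ Icc 1 z, (∑ e ∈ (Icc 1 z).filter (fun e => n ∣ e),
      if e ∣ k then (ArithmeticFunction.moebius e : ℝ) / sL z * sg k else 0) =
      if n = k then (ArithmeticFunction.moebius n : ℝ) * sg n / sL z else 0 := by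
    intro k hk
    rw [mem_Icc] at hk
    by_cases hsq : Squarefree k
    · have h3 := mu_sum n k (by omega) hsq
      have h4 : ((Icc 1 z).filter (fun e => n ∣ e)).filter (fun e => e ∣ k) =
          k.divisors.filter (fun e => n ∣ e) := by
        ext e
        simp only [mem_filter, mem_Icc, Nat.mem_divisors]
        constructor
        · rintro ⟨⟨_, h⟩, h'⟩; exact ⟨⟨h', by omega⟩, h⟩
        · rintro ⟨⟨h, _⟩, h'⟩
          have := Nat.le_of_dvd (by omega) h
          have := Nat.pos_of_dvd_of_pos h (by omega)
          exact ⟨⟨⟨by omega, by omega⟩, h'⟩, h⟩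
      rw [← Finset.sum_filter, h4, ← Finset.sum_mul, ← Finset.sum_div]
      have h5 : ∑ e ∈ k.divisors.filter (fun e => n ∣ e), (ArithmeticFunction.moebius e : ℝ) =
          ((if n = k then ArithmeticFunction.moebius n else 0 : ℤ) : ℝ) := by
        rw [← h3]; push_cast; rfl
      rw [h5]
      split_ifs with h
      · subst h; ring
      · simp
    · have : sg k = 0 := by simp [sg, hsq]
      split_ifs with h
      · subst h; simp [this]
      · simp [this]
  rw [Finset.sum_congr rfl h2, Finset.sum_ite_eq, if_pos (by simpa using hn)]

lemma slam_quad (z : ℕ) (hz : 1 ≤ z) :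
    ∑ e ∈ Icc 1 z, ∑ e' ∈ Icc 1 z, slam z e * slam z e' / (Nat.lcm e e' : ℝ) = 1 / sL z := by
  have hL := sL_pos z hz
  have h1 : ∀ e ∈ Icc 1 z, ∀ e' ∈ Icc 1 z, slam z e * slam z e' / (Nat.lcm e e' : ℝ) =
      ∑ n ∈ Icc 1 z, (n.totient : ℝ) * ((if n ∣ e then slam z e / e else 0) *
        (if n ∣ e' then slam z e' / e' else 0)) := by
    intro e he e' he'
    rw [mem_Icc] at he he'
    have h2 : ((e.gcd e' : ℕ) : ℝ) = ∑ n ∈ Icc 1 z, if n ∣ e ∧ n ∣ e' then (n.totient : ℝ) else 0 := by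
      conv_lhs => rw [← Nat.sum_totient (e.gcd e')]
      rw [← Finset.sum_filter]
      push_cast
      refine Finset.sum_congr ?_ fun _ _ => rfl
      ext n
      simp only [Nat.mem_divisors, mem_filter, mem_Icc, Nat.dvd_gcd_iff]
      constructor
      · rintro ⟨⟨h, h'⟩, _⟩
        have := Nat.le_of_dvd (by omega) h
        have := Nat.pos_of_dvd_of_pos h (by omega)
        exact ⟨⟨by omega, by omega⟩, h, h'⟩
      · rintro ⟨_, h⟩
        exact ⟨h, Nat.gcd_ne_zero_left (by omega)⟩
    have h3 : ((e.gcd e' : ℕ) : ℝ) * (Nat.lcm e e' : ℕ) = e * e' := by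
      exact_mod_cast Nat.gcd_mul_lcm e e'
    have hl : ((Nat.lcm e e' : ℕ) : ℝ) ≠ 0 := by
      have : Nat.lcm e e' ≠ 0 := Nat.lcm_ne_zero (by omega) (by omega)
      exact_mod_cast this
    have he0 : (e : ℝ) ≠ 0 := by have := he.1; positivity
    have he0' : (e' : ℝ) ≠ 0 := by have := he'.1; positivity
    have h4 : slam z e * slam z e' / (Nat.lcm e e' : ℝ) =
        ((e.gcd e' : ℕ) : ℝ) * (slam z e / e * (slam z e' / e')) := by
      field_simp
      rw [mul_assoc, ← h3]; ring
    rw [h4, h2, Finset.sum_mul]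
    refine Finset.sum_congr rfl fun n _ => ?_
    by_cases h5 : n ∣ e <;> by_cases h6 : n ∣ e' <;> simp [h5, h6]
  have h2 : ∑ e ∈ Icc 1 z, ∑ e' ∈ Icc 1 z, slam z e * slam z e' / (Nat.lcm e e' : ℝ) =
      ∑ n ∈ Icc 1 z, (n.totient : ℝ) * (∑ e ∈ Icc 1 z with n ∣ e, slam z e / e) ^ 2 := by
    rw [Finset.sum_congr rfl fun e he => Finset.sum_congr rfl fun e' he' => h1 e he e' he']
    simp_rw [Finset.sum_comm (s := Icc 1 z) (t := Icc 1 z)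
      (f := fun e' n => (n.totient : ℝ) * ((if n ∣ _ then _ else 0) * (if n ∣ e' then _ else 0)))]
    rw [Finset.sum_comm]
    refine Finset.sum_congr rfl fun n _ => ?_
    rw [sq, Finset.sum_filter, Finset.sum_mul_sum, Finset.mul_sum]
    refine Finset.sum_congr rfl fun e _ => ?_
    rw [Finset.mul_sum]
  rw [h2]
  have h3 : ∀ n ∈ Icc 1 z, (n.totient : ℝ) * (∑ e ∈ Icc 1 z with n ∣ e, slam z e / e) ^ 2 =
      sg n / sL z ^ 2 := by
    intro n hn
    rw [slam_inner z n hn]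
    rw [mem_Icc] at hn
    by_cases hsq : Squarefree n
    · have hmu : (ArithmeticFunction.moebius n : ℝ) ^ 2 = 1 := by
        have := ArithmeticFunction.moebius_sq_eq_one_of_squarefree hsq
        exact_mod_cast this
      have hφ : (n.totient : ℝ) ≠ 0 := by
        have := Nat.totient_pos.2 hn.1
        positivity
      rw [div_pow, mul_pow, hmu, sg, if_pos hsq]
      field_simp
    · simp [sg, hsq]
  rw [Finset.sum_congr rfl h3, ← Finset.sum_div]
  change sL z / _ = _
  field_simp

/-- the Selberg majorant -/
def sw (z d : ℕ) : ℝ := (∑ e ∈ Icc 1 z with e ∣ d, slam z e) ^ 2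

lemma sw_expand (z N : ℕ) (G : ℕ → ℝ) :
    ∑ d ∈ Icc 1 N, sw z d * G d = ∑ e ∈ Icc 1 z, ∑ e' ∈ Icc 1 z,
      slam z e * slam z e' * ∑ d ∈ Icc 1 N with Nat.lcm e e' ∣ d, G d := by
  have h : ∀ d, sw z d * G d = ∑ e ∈ Icc 1 z, ∑ e' ∈ Icc 1 z,
      slam z e * slam z e' * (if Nat.lcm e e' ∣ d then G d else 0) := by
    intro d
    rw [sw, sq, Finset.sum_filter, Finset.sum_mul_sum, Finset.sum_mul]
    refine Finset.sum_congr rfl fun e _ => ?_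
    rw [Finset.sum_mul]
    refine Finset.sum_congr rfl fun e' _ => ?_
    by_cases h5 : e ∣ d <;> by_cases h6 : e' ∣ d <;> simp [h5, h6, Nat.lcm_dvd_iff]
  simp_rw [h]
  rw [Finset.sum_comm]
  refine Finset.sum_congr rfl fun e _ => ?_
  rw [Finset.sum_comm]
  refine Finset.sum_congr rfl fun e' _ => ?_
  rw [← Finset.mul_sum, Finset.sum_filter]

lemma slam_abs_sum (z : ℕ) (hz : 1 ≤ z) :
    ∑ e ∈ Icc 1 z, ∑ e' ∈ Icc 1 z, |slam z e * slam z e'| ≤ (z : ℝ) ^ 4 := by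
  have h : ∀ e ∈ Icc 1 z, |slam z e| ≤ z := fun e he =>
    (slam_abs z e hz).trans (by exact_mod_cast (mem_Icc.1 he).2)
  calc _ ≤ ∑ e ∈ Icc 1 z, ∑ e' ∈ Icc 1 z, (z : ℝ) * z := by
        refine Finset.sum_le_sum fun e he => Finset.sum_le_sum fun e' he' => ?_
        rw [abs_mul]
        exact mul_le_mul (h e he) (h e' he') (abs_nonneg _) (by positivity)
    _ = _ := by simp; ring

lemma sw_total (z N : ℕ) (hz : 2 ≤ z) :
    ∑ d ∈ Icc 1 N, sw z d ≤ 2 * N / Real.log z + (z : ℝ) ^ 4 := by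
  have hL := sL_pos z (by omega)
  have h := sw_expand z N (fun _ => 1)
  simp only [mul_one] at h
  rw [h]
  have h1 : ∀ e ∈ Icc 1 z, ∀ e' ∈ Icc 1 z,
      slam z e * slam z e' * ∑ d ∈ Icc 1 N with Nat.lcm e e' ∣ d, (1:ℝ) ≤
      N * (slam z e * slam z e' / (Nat.lcm e e' : ℝ)) + |slam z e * slam z e'| := by
    intro e he e' he'
    rw [mem_Icc] at he he'
    have hl : 0 < Nat.lcm e e' := Nat.lcm_pos (by omega) (by omega)
    have h2 : ∑ d ∈ Icc 1 N with Nat.lcm e e' ∣ d, (1:ℝ) = ((N / Nat.lcm e e' : ℕ) : ℝ) := by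
      rw [Finset.sum_const, nsmul_eq_mul, mul_one]
      congr 1
      exact Nat.Ioc_filter_dvd_card_eq_div N _
    rw [h2]
    set l := Nat.lcm e e'
    have h3 : ((N / l : ℕ) : ℝ) ≤ (N : ℝ) / l := Nat.cast_div_le
    have h4 : (N : ℝ) / l < ((N / l : ℕ) : ℝ) + 1 := by
      rw [div_lt_iff₀ (by exact_mod_cast hl)]
      exact_mod_cast (by have := Nat.lt_div_mul_add hl (a := N); linarith : N < (N / l + 1) * l)
    have h5 : slam z e * slam z e' * ((N / l : ℕ) : ℝ) - slam z e * slam z e' * ((N : ℝ) / l)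
        ≤ |slam z e * slam z e'| := by
      rw [← mul_sub]
      refine (le_abs_self _).trans ?_
      rw [abs_mul]
      refine mul_le_of_le_one_right (abs_nonneg _) ?_
      rw [abs_le]; constructor <;> linarith
    have : N * (slam z e * slam z e' / (l : ℝ)) = slam z e * slam z e' * ((N : ℝ) / l) := by ring
    linarith
  refine (Finset.sum_le_sum fun e he => Finset.sum_le_sum fun e' he' => h1 e he e' he').trans ?_
  simp_rw [Finset.sum_add_distrib, ← Finset.mul_sum]
  rw [slam_quad z (by omega)]
  have h6 := slam_abs_sum z (by omega)
  have h7 := sL_ge z (by omega)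
  have hlog : 0 < Real.log z := Real.log_pos (by exact_mod_cast hz)
  have : (N : ℝ) * (1 / sL z) ≤ 2 * N / Real.log z := by
    rw [mul_one_div, div_le_div_iff₀ hL hlog]
    nlinarith [Nat.cast_nonneg (α := ℝ) N]
  linarith

lemma sw_nonneg (z d : ℕ) : 0 ≤ sw z d := sq_nonneg _

lemma sw_prime (z p : ℕ) (hz : 1 ≤ z) (hp : p.Prime) (h : z < p) : sw z p = 1 := by
  have : (Icc 1 z).filter (fun e => e ∣ p) = {1} := by
    ext e
    simp only [mem_filter, mem_Icc, mem_singleton]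
    constructor
    · rintro ⟨⟨_, h1⟩, h2⟩
      rcases (Nat.dvd_prime hp).1 h2 with h3 | h3 <;> omega
    · rintro rfl; simp [hz]
  rw [sw, this, Finset.sum_singleton, slam_one z hz, one_pow]

lemma jac_prod {ι : Type*} (s : Finset ι) (t : ι → ℕ) (d : ℕ) :
    jacobiSym ((∏ i ∈ s, t i : ℕ) : ℤ) d = ∏ i ∈ s, jacobiSym (t i : ℤ) d := by
  classical
  induction s using Finset.induction_on with
  | empty => simp
  | insert a s ha ih =>
    rw [Finset.prod_insert ha, Finset.prod_insert ha, ← ih]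
    push_cast
    rw [jacobiSym.mul_left]

lemma S_pow (m d k : ℕ) :
    S m d ^ k = ∑ t ∈ Fintype.piFinset (fun _ : Fin k => Icc 1 m),
      jacobiSym ((∏ i, t i : ℕ) : ℤ) d := by
  have h := Finset.prod_univ_sum (fun _ : Fin k => Icc 1 m)
    (fun _ n => jacobiSym ((n : ℕ) : ℤ) d)
  simp only [Finset.prod_const, Finset.card_univ, Fintype.card_fin] at h
  rw [S, h]
  exact Finset.sum_congr rfl fun t _ => (jac_prod _ _ _).symm

lemma sq_count : ∃ C : ℝ, 0 < C ∧ ∀ m : ℕ, 1 ≤ m →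
    (((Fintype.piFinset (fun _ : Fin 4 => Icc 1 m)).filter
      (fun t => IsSquare (∏ i, t i))).card : ℝ) ≤ C * ((m : ℝ) ^ 2 * (m : ℝ) ^ (1 / 2 : ℝ)) := by
  obtain ⟨C, hC, hdiv⟩ := divisor_bound (1 / 32) (by norm_num)
  refine ⟨C ^ 4, by positivity, fun m hm => ?_⟩
  have h1 : (Fintype.piFinset (fun _ : Fin 4 => Icc 1 m)).filter (fun t => IsSquare (∏ i, t i)) ⊆
      (Icc 1 (m ^ 2)).biUnion (fun u =>
        (Fintype.piFinset (fun _ : Fin 4 => Icc 1 m)).filter (fun t => ∏ i, t i = u * u)) := by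
    intro t ht
    simp only [mem_filter] at ht
    obtain ⟨ht, u, hu⟩ := ht
    simp only [mem_biUnion, mem_filter]
    have hmem : ∀ i, 1 ≤ t i ∧ t i ≤ m := by
      intro i; simpa using Fintype.mem_piFinset.1 ht i
    refine ⟨u, ?_, ht, hu⟩
    have hpos : 0 < ∏ i, t i := Finset.prod_pos fun i _ => (hmem i).1
    have hle : ∏ i, t i ≤ m ^ 4 := by
      have := Finset.prod_le_pow_card Finset.univ t m (fun i _ => (hmem i).2)
      simpa using this
    rw [mem_Icc]
    constructor
    · rcases Nat.eq_zero_or_pos u with rfl | h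
      · simp [hu] at hpos
      · exact h
    · rw [hu] at hle
      nlinarith
  have h2 : ∀ u ∈ Icc 1 (m ^ 2),
      (((Fintype.piFinset (fun _ : Fin 4 => Icc 1 m)).filter (fun t => ∏ i, t i = u * u)).card : ℝ)
      ≤ C ^ 4 * (m : ℝ) ^ (1 / 2 : ℝ) := by
    intro u hu
    rw [mem_Icc] at hu
    have h3 := tuple_count 4 m (u * u) (by nlinarith)
    have h4 := hdiv (u * u) (by nlinarith)
    have h5 : (((u * u : ℕ) : ℝ)) ^ (1 / 32 : ℝ) ≤ (m : ℝ) ^ (1 / 8 : ℝ) := by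
      calc (((u * u : ℕ) : ℝ)) ^ (1 / 32 : ℝ) ≤ ((m : ℝ) ^ (4:ℕ)) ^ (1 / 32 : ℝ) := by
            apply Real.rpow_le_rpow (by positivity) _ (by norm_num)
            exact_mod_cast (by nlinarith : u * u ≤ m ^ 4)
        _ = _ := by
            rw [← Real.rpow_natCast, ← Real.rpow_mul (by positivity)]; norm_num
    calc _ ≤ (((u * u).divisors.card : ℝ)) ^ 4 := by exact_mod_cast h3
      _ ≤ (C * (m : ℝ) ^ (1 / 8 : ℝ)) ^ 4 := by gcongr; exact h4.trans (by gcongr)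
      _ = _ := by
        rw [mul_pow, ← Real.rpow_natCast ((m : ℝ) ^ (1 / 8 : ℝ)), ← Real.rpow_mul (by positivity)]
        norm_num
  calc _ ≤ (((Icc 1 (m ^ 2)).biUnion (fun u =>
        (Fintype.piFinset (fun _ : Fin 4 => Icc 1 m)).filter
          (fun t => ∏ i, t i = u * u))).card : ℝ) := by exact_mod_cast Finset.card_le_card h1
    _ ≤ ∑ u ∈ Icc 1 (m ^ 2), (((Fintype.piFinset (fun _ : Fin 4 => Icc 1 m)).filter
          (fun t => ∏ i, t i = u * u)).card : ℝ) := by exact_mod_cast Finset.card_biUnion_le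
    _ ≤ ∑ u ∈ Icc 1 (m ^ 2), C ^ 4 * (m : ℝ) ^ (1 / 2 : ℝ) := Finset.sum_le_sum h2
    _ = _ := by simp; ring

lemma JF_sum_mult (n l N : ℕ) (hn : n ≠ 0) (hsq : ¬ IsSquare n) (hl : 0 < l) :
    |∑ d ∈ Icc 1 N with l ∣ d, JF n d| ≤ 4 * n := by
  have h0 : JF n 0 = 0 := by simp [JF]
  have h1 : (Icc 1 N).filter (fun d => l ∣ d) = (Icc 1 (N / l)).image (fun d => l * d) := by
    ext d
    simp only [mem_filter, mem_Icc, mem_image]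
    constructor
    · rintro ⟨⟨h1, h2⟩, c, rfl⟩
      refine ⟨c, ⟨?_, ?_⟩, rfl⟩
      · rcases Nat.eq_zero_or_pos c with rfl | h
        · simp at h1
        · exact h
      · rw [Nat.le_div_iff_mul_le hl]; linarith
    · rintro ⟨c, ⟨h1, h2⟩, rfl⟩
      rw [Nat.le_div_iff_mul_le hl] at h2
      exact ⟨⟨Nat.mul_pos hl h1, by linarith⟩, Dvd.intro _ rfl⟩
  rw [h1, Finset.sum_image (fun a _ b _ h => Nat.eq_of_mul_eq_mul_left hl h)]
  simp only [JF_mul, ← Finset.mul_sum]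
  have h2 : ∑ d ∈ Icc 1 (N / l), JF n d = ∑ d ∈ range (N / l + 1), JF n d := by
    rw [Finset.range_eq_Ico, Finset.sum_eq_sum_Ico_succ_bot (Nat.succ_pos _), h0, zero_add]
    rfl
  rw [h2, abs_mul]
  have := JF_sum n hn hsq (N / l + 1)
  have h3 := JF_abs_le n l
  nlinarith [abs_nonneg (∑ d ∈ range (N / l + 1), JF n d)]

lemma sw_nonsq (n z N : ℕ) (hn : n ≠ 0) (hsq : ¬ IsSquare n) (hz : 1 ≤ z) :
    ∑ d ∈ Icc 1 N, sw z d * (JF n d : ℝ) ≤ (z : ℝ) ^ 4 * (4 * n) := by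
  rw [sw_expand]
  calc _ ≤ ∑ e ∈ Icc 1 z, ∑ e' ∈ Icc 1 z, |slam z e * slam z e'| * (4 * n : ℝ) := by
        refine Finset.sum_le_sum fun e he => Finset.sum_le_sum fun e' he' => ?_
        rw [mem_Icc] at he he'
        refine (le_abs_self _).trans ?_
        rw [abs_mul]
        gcongr
        have := JF_sum_mult n (Nat.lcm e e') N hn hsq (Nat.lcm_pos (by omega) (by omega))
        exact_mod_cast this
    _ = (∑ e ∈ Icc 1 z, ∑ e' ∈ Icc 1 z, |slam z e * slam z e'|) * (4 * n : ℝ) := by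
        simp_rw [← Finset.sum_mul]
    _ ≤ _ := by gcongr; exact slam_abs_sum z hz

lemma sw_le_total (n z N : ℕ) :
    ∑ d ∈ Icc 1 N, sw z d * (JF n d : ℝ) ≤ ∑ d ∈ Icc 1 N, sw z d := by
  refine Finset.sum_le_sum fun d _ => ?_
  have h := (abs_le.1 (JF_abs_le n d)).2
  have h' : (JF n d : ℝ) ≤ 1 := by exact_mod_cast h
  nlinarith [sw_nonneg z d]

lemma moment_bound : ∃ C : ℝ, 0 < C ∧ ∀ m N z : ℕ, 1 ≤ m → 2 ≤ z →
    ∑ d ∈ Icc 1 N, sw z d * (if Odd d then (S m d : ℝ) ^ 4 else 0) ≤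
      C * ((m : ℝ) ^ 2 * (m : ℝ) ^ (1 / 2 : ℝ)) * (2 * N / Real.log z + (z : ℝ) ^ 4)
        + (m : ℝ) ^ 4 * ((z : ℝ) ^ 4 * (4 * (m : ℝ) ^ 4)) := by
  obtain ⟨C, hC, hsq⟩ := sq_count
  refine ⟨C, hC, fun m N z hm hz => ?_⟩
  set T := Fintype.piFinset (fun _ : Fin 4 => Icc 1 m) with hT
  have hmem : ∀ t ∈ T, ∀ i, 1 ≤ t i ∧ t i ≤ m := by
    intro t ht i; simpa using Fintype.mem_piFinset.1 ht i
  have h1 : ∀ d, (if Odd d then (S m d : ℝ) ^ 4 else 0) = ∑ t ∈ T, (JF (∏ i, t i) d : ℝ) := by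
    intro d
    by_cases hd : Odd d
    · have := S_pow m d 4
      simp only [hd, if_true, JF]
      exact_mod_cast this
    · simp [hd, JF]
  simp_rw [h1, Finset.mul_sum]
  rw [Finset.sum_comm, ← Finset.sum_filter_add_sum_filter_not T (fun t => IsSquare (∏ i, t i))]
  have hW := sw_total z N hz
  have hW0 : 0 ≤ 2 * N / Real.log z + (z : ℝ) ^ 4 := by
    have : 0 < Real.log z := Real.log_pos (by exact_mod_cast hz)
    positivity
  refine add_le_add ?_ ?_
  · calc _ ≤ ∑ t ∈ T with IsSquare (∏ i, t i), (2 * N / Real.log z + (z : ℝ) ^ 4) :=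
          Finset.sum_le_sum fun t _ => (sw_le_total _ _ _).trans hW
      _ = ((T.filter (fun t => IsSquare (∏ i, t i))).card : ℝ) * _ := by
          rw [Finset.sum_const, nsmul_eq_mul]
      _ ≤ _ := by gcongr; exact hsq m hm
  · calc _ ≤ ∑ t ∈ T with ¬ IsSquare (∏ i, t i), ((z : ℝ) ^ 4 * (4 * (m : ℝ) ^ 4)) := by
          refine Finset.sum_le_sum fun t ht => ?_
          simp only [mem_filter] at ht
          have hpos : 0 < ∏ i, t i := Finset.prod_pos fun i _ => (hmem t ht.1 i).1
          refine (sw_nonsq _ z N hpos.ne' ht.2 (by omega)).trans ?_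
          have hle : ∏ i, t i ≤ m ^ 4 := by
            have := Finset.prod_le_pow_card Finset.univ t m (fun i _ => (hmem t ht.1 i).2)
            simpa using this
          gcongr
          exact_mod_cast hle
      _ = ((T.filter (fun t => ¬ IsSquare (∏ i, t i))).card : ℝ) * _ := by
          rw [Finset.sum_const, nsmul_eq_mul]
      _ ≤ _ := by
          gcongr
          have : (T.filter (fun t => ¬ IsSquare (∏ i, t i))).card ≤ m ^ 4 := by
            refine (Finset.card_filter_le _ _).trans ?_
            simp [hT]
          exact_mod_cast this

/-- bad primes -/
def Bad (ε : ℝ) (m N : ℕ) : Finset ℕ :=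
  ((range (N + 1)).filter (fun p => p.Prime ∧ p ≠ 2)).filter (fun p => ε * m ≤ (S m p : ℝ))

lemma bad_small (ε : ℝ) (hε : 0 < ε) : ∃ C : ℝ, 0 < C ∧ ∀ m N z : ℕ, 1 ≤ m → 2 ≤ z →
    ((Bad ε m N).card : ℝ) ≤ z + C * ((m : ℝ) ^ (-(3 / 2) : ℝ) *
      (2 * N / Real.log z + (z : ℝ) ^ 4) + (z : ℝ) ^ 4 * (m : ℝ) ^ 4) := by
  obtain ⟨C, hC, hmom⟩ := moment_bound
  refine ⟨(C + 4) / ε ^ 4, by positivity, fun m N z hm hz => ?_⟩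
  have hm0 : (0:ℝ) < m := by exact_mod_cast hm
  set B1 := (Bad ε m N).filter (fun p => z < p) with hB1
  have h1 : ((Bad ε m N).card : ℝ) ≤ z + B1.card := by
    have h2 : (Bad ε m N).card = ((Bad ε m N).filter (fun p => ¬ z < p)).card + B1.card := by
      rw [add_comm]; exact (Finset.card_filter_add_card_filter_not _).symm
    have h3 : ((Bad ε m N).filter (fun p => ¬ z < p)).card ≤ z := by
      calc _ ≤ (Icc 1 z).card := by
            refine Finset.card_le_card fun p hp => ?_
            simp only [Bad, mem_filter] at hp
            have := hp.1.1.2.1.pos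
            rw [mem_Icc]; omega
        _ = z := by simp
    exact_mod_cast (by omega : (Bad ε m N).card ≤ z + B1.card)
  have hm4 := hmom m N z hm hz
  have h2 : (B1.card : ℝ) * (ε * m) ^ 4 ≤
      ∑ d ∈ Icc 1 N, sw z d * (if Odd d then (S m d : ℝ) ^ 4 else 0) := by
    calc (B1.card : ℝ) * (ε * m) ^ 4 = ∑ p ∈ B1, (ε * m) ^ 4 := by
          rw [Finset.sum_const, nsmul_eq_mul]
      _ ≤ ∑ p ∈ B1, sw z p * (if Odd p then (S m p : ℝ) ^ 4 else 0) := by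
          refine Finset.sum_le_sum fun p hp => ?_
          simp only [hB1, Bad, mem_filter] at hp
          obtain ⟨⟨⟨_, hp1, hp2⟩, hp3⟩, hp4⟩ := hp
          rw [sw_prime z p (by omega) hp1 hp4, one_mul, if_pos (hp1.odd_of_ne_two hp2)]
          gcongr
      _ ≤ _ := by
          refine Finset.sum_le_sum_of_subset_of_nonneg ?_ fun d _ _ => ?_
          · intro p hp
            simp only [hB1, Bad, mem_filter, mem_range] at hp
            rw [mem_Icc]
            have := hp.1.1.2.1.pos
            omega
          · refine mul_nonneg (sw_nonneg _ _) ?_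
            split_ifs <;> positivity
  refine h1.trans ?_
  gcongr
  have h3 := h2.trans hm4
  set W := 2 * N / Real.log z + (z : ℝ) ^ 4 with hW
  have hW0 : 0 ≤ W := by
    have : 0 < Real.log z := Real.log_pos (by exact_mod_cast hz)
    positivity
  have h4 : (m : ℝ) ^ 2 * (m : ℝ) ^ (1 / 2 : ℝ) = (m : ℝ) ^ 4 * (m : ℝ) ^ (-(3 / 2) : ℝ) := by
    rw [← Real.rpow_natCast, ← Real.rpow_natCast, ← Real.rpow_add hm0, ← Real.rpow_add hm0]
    norm_num
  rw [h4] at h3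
  set r := (m : ℝ) ^ (-(3 / 2) : ℝ)
  have hr : 0 ≤ r := by positivity
  have h5 : (B1.card : ℝ) * ε ^ 4 ≤ C * r * W + 4 * (z ^ 4 * m ^ 4) := by
    have : (B1.card : ℝ) * ε ^ 4 * m ^ 4 ≤ (C * r * W + 4 * (z ^ 4 * m ^ 4)) * m ^ 4 := by
      calc _ = (B1.card : ℝ) * (ε * m) ^ 4 := by ring
        _ ≤ _ := h3
        _ = _ := by ring
    exact le_of_mul_le_mul_right this (by positivity)
  rw [div_mul_eq_mul_div, le_div_iff₀ (by positivity)]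
  refine h5.trans ?_
  have h6 : 0 ≤ r * W := by positivity
  have h7 : (0:ℝ) ≤ z ^ 4 * m ^ 4 := by positivity
  nlinarith

lemma G_sq (P : Finset ℕ) (N R : ℕ) (hP : ∀ p ∈ P, p.Prime ∧ p ≠ 2 ∧ p ≤ N) :
    ∑ n ∈ range (R + 1), (∑ p ∈ P, jacobiSym (n : ℤ) p) ^ 2 ≤
      (P.card : ℤ) * (R + 1) + (P.card : ℤ) ^ 2 * N ^ 2 := by
  have h1 : ∑ n ∈ range (R + 1), (∑ p ∈ P, jacobiSym (n : ℤ) p) ^ 2 =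
      ∑ p ∈ P, ∑ q ∈ P, ∑ n ∈ range (R + 1), jacobiSym (n : ℤ) p * jacobiSym (n : ℤ) q := by
    simp_rw [sq, Finset.sum_mul_sum]
    rw [Finset.sum_comm]
    refine Finset.sum_congr rfl fun p _ => ?_
    rw [Finset.sum_comm]
  rw [h1]
  have h2 : ∀ p ∈ P, ∀ q ∈ P, ∑ n ∈ range (R + 1), jacobiSym (n : ℤ) p * jacobiSym (n : ℤ) q ≤
      (if p = q then ((R : ℤ) + 1) else 0) + N ^ 2 := by
    intro p hp q hq
    obtain ⟨hp1, hp2, hp3⟩ := hP p hp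
    obtain ⟨hq1, hq2, hq3⟩ := hP q hq
    split_ifs with h
    · have : ∑ n ∈ range (R + 1), jacobiSym (n : ℤ) p * jacobiSym (n : ℤ) q ≤
          ∑ n ∈ range (R + 1), 1 := by
        refine Finset.sum_le_sum fun n _ => ?_
        have h3 := jac_abs_le n p
        have h4 := jac_abs_le n q
        refine (le_abs_self _).trans ?_
        rw [abs_mul]
        exact mul_le_one₀ h3 (abs_nonneg _) h4
      simp only [sum_const, card_range, nsmul_eq_mul, mul_one] at this
      push_cast at this
      nlinarith [sq_nonneg (N : ℤ)]
    · have h3 := pq_sum p q hp1 hq1 hp2 h (R + 1)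
      have h4 := (abs_le.1 h3).2
      have : (p : ℤ) * q ≤ N ^ 2 := by
        rw [sq]; exact_mod_cast Nat.mul_le_mul hp3 hq3
      linarith
  refine (Finset.sum_le_sum fun p hp => Finset.sum_le_sum fun q hq => h2 p hp q hq).trans ?_
  simp_rw [Finset.sum_add_distrib, Finset.sum_ite_eq]
  rw [Finset.sum_ite_mem, Finset.inter_self]
  simp only [sum_const, nsmul_eq_mul]
  apply le_of_eq
  ring

lemma bad_large_aux (k : ℕ) (hk : 0 < k) : ∃ A : ℝ, 0 < A ∧ ∀ (y : ℕ), 1 ≤ y → ∀ n ∈ Icc 1 (y ^ k),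
    (((Fintype.piFinset (fun _ : Fin k => Icc 1 y)).filter (fun t => ∏ i, t i = n)).card : ℝ)
      ≤ A * y := by
  obtain ⟨C, hC, hdiv⟩ := divisor_bound (1 / ((k : ℝ) * k)) (by positivity)
  refine ⟨C ^ k, by positivity, fun y hy n hn => ?_⟩
  rw [mem_Icc] at hn
  have h1 := tuple_count k y n (by omega)
  have h2 := hdiv n (by omega)
  have h3 : (n : ℝ) ^ (1 / ((k : ℝ) * k)) ≤ (y : ℝ) ^ (1 / (k : ℝ)) := by
    calc (n : ℝ) ^ (1 / ((k : ℝ) * k)) ≤ ((y : ℝ) ^ k) ^ (1 / ((k : ℝ) * k)) := by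
          apply Real.rpow_le_rpow (by positivity) _ (by positivity)
          exact_mod_cast hn.2
      _ = _ := by
          rw [← Real.rpow_natCast, ← Real.rpow_mul (by positivity)]
          congr 1; field_simp
  calc _ ≤ ((n.divisors.card : ℝ)) ^ k := by exact_mod_cast h1
    _ ≤ (C * (y : ℝ) ^ (1 / (k : ℝ))) ^ k := by gcongr; exact h2.trans (by gcongr)
    _ = _ := by
      rw [mul_pow, ← Real.rpow_natCast ((y : ℝ) ^ (1 / (k : ℝ))), ← Real.rpow_mul (by positivity)]
      congr 1
      rw [one_div_mul_cancel (by positivity), Real.rpow_one]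

lemma bad_large (ε : ℝ) (hε : 0 < ε) (D : ℝ) : ∃ C : ℝ, 0 < C ∧ ∃ y0 : ℕ,
    ∀ y N : ℕ, y0 ≤ y → (N : ℝ) ^ 2 ≤ D * (y : ℝ) ^ 64 →
    ((Bad ε y N).card : ℝ) ≤ C * y := by
  obtain ⟨k, hk⟩ : ∃ k : ℕ, k = 67 := ⟨_, rfl⟩
  obtain ⟨A, hA, hA'⟩ := bad_large_aux k (by omega)
  obtain ⟨y0, hy0⟩ := exists_nat_gt (2 * A * D / ε ^ (2 * k))
  refine ⟨4 * A / ε ^ (2 * k), by positivity, y0 + 1, fun y N hy hN => ?_⟩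
  have hy1 : 1 ≤ y := by omega
  have hyR : (1:ℝ) ≤ y := by exact_mod_cast hy1
  set P := Bad ε y N with hPdef
  have hP : ∀ p ∈ P, p.Prime ∧ p ≠ 2 ∧ p ≤ N := by
    intro p hp
    simp only [hPdef, Bad, mem_filter, mem_range] at hp
    exact ⟨hp.1.2.1, hp.1.2.2, by omega⟩
  set T := Fintype.piFinset (fun _ : Fin k => Icc 1 y) with hT
  set a : ℕ → ℝ := fun n => ((T.filter (fun t => ∏ i, t i = n)).card : ℝ) with ha
  set G : ℕ → ℝ := fun n => ((∑ p ∈ P, jacobiSym (n : ℤ) p : ℤ) : ℝ) with hG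
  have hmaps : ∀ t ∈ T, ∏ i, t i ∈ Icc 1 (y ^ k) := by
    intro t ht
    have hmem : ∀ i, 1 ≤ t i ∧ t i ≤ y := by
      intro i; simpa using Fintype.mem_piFinset.1 ht i
    rw [mem_Icc]
    refine ⟨Nat.succ_le_of_lt (Finset.prod_pos fun i _ => (hmem i).1), ?_⟩
    have := Finset.prod_le_pow_card Finset.univ t y (fun i _ => (hmem i).2)
    simpa using this
  have h1 : ∑ p ∈ P, (S y p : ℝ) ^ k = ∑ n ∈ Icc 1 (y ^ k), a n * G n := by
    have e1 : ∑ p ∈ P, (S y p : ℝ) ^ k = ∑ t ∈ T, G (∏ i, t i) := by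
      have : ∑ p ∈ P, (S y p) ^ k = ∑ t ∈ T, ∑ p ∈ P, jacobiSym ((∏ i, t i : ℕ) : ℤ) p := by
        rw [Finset.sum_comm]
        exact Finset.sum_congr rfl fun p _ => S_pow y p k
      simp only [hG]
      exact_mod_cast this
    rw [e1, ← Finset.sum_fiberwise_of_maps_to hmaps]
    refine Finset.sum_congr rfl fun n _ => ?_
    rw [Finset.sum_congr rfl (g := fun _ => G n) (fun t ht => by rw [(mem_filter.1 ht).2])]
    rw [Finset.sum_const, nsmul_eq_mul]
  have h2 : (P.card : ℝ) * (ε * y) ^ k ≤ ∑ p ∈ P, (S y p : ℝ) ^ k := by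
    rw [← nsmul_eq_mul, ← Finset.sum_const]
    refine Finset.sum_le_sum fun p hp => ?_
    simp only [hPdef, Bad, mem_filter] at hp
    exact pow_le_pow_left₀ (by positivity) hp.2 k
  have h3 : ∑ n ∈ Icc 1 (y ^ k), a n ^ 2 ≤ A * y * y ^ k := by
    have e2 : ∑ n ∈ Icc 1 (y ^ k), a n = (y : ℝ) ^ k := by
      have : ∑ n ∈ Icc 1 (y ^ k), (T.filter (fun t => ∏ i, t i = n)).card = y ^ k := by
        rw [← Finset.card_eq_sum_card_fiberwise hmaps]
        simp [hT]
      simp only [ha]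
      exact_mod_cast this
    rw [← e2, Finset.mul_sum]
    refine Finset.sum_le_sum fun n hn => ?_
    rw [sq]
    exact mul_le_mul_of_nonneg_right (hA' y hy1 n hn) (by positivity)
  have h4 : ∑ n ∈ Icc 1 (y ^ k), G n ^ 2 ≤ (P.card : ℝ) * (2 * y ^ k) + (P.card : ℝ) ^ 2 * N ^ 2 := by
    have e3 := G_sq P N (y ^ k) hP
    have e4 : ∑ n ∈ range (y ^ k + 1), G n ^ 2 ≤
        (P.card : ℝ) * ((y : ℝ) ^ k + 1) + (P.card : ℝ) ^ 2 * N ^ 2 := by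
      simp only [hG]
      exact_mod_cast e3
    have e5 : ∑ n ∈ Icc 1 (y ^ k), G n ^ 2 ≤ ∑ n ∈ range (y ^ k + 1), G n ^ 2 := by
      refine Finset.sum_le_sum_of_subset_of_nonneg ?_ fun n _ _ => sq_nonneg _
      intro n hn
      rw [mem_Icc] at hn
      rw [mem_range]; omega
    have e6 : (1:ℝ) ≤ (y : ℝ) ^ k := one_le_pow₀ hyR
    have e7 : (P.card : ℝ) * ((y : ℝ) ^ k + 1) ≤ (P.card : ℝ) * (2 * y ^ k) := by
      gcongr; linarith
    linarith
  have h5 := Finset.sum_mul_sq_le_sq_mul_sq (Icc 1 (y ^ k)) a G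
  rw [← h1] at h5
  set c : ℝ := (P.card : ℝ) with hc
  have hc0 : 0 ≤ c := Nat.cast_nonneg _
  have h6 : (c * (ε * y) ^ k) ^ 2 ≤ (A * y * y ^ k) * (c * (2 * y ^ k) + c ^ 2 * N ^ 2) := by
    calc _ ≤ (∑ p ∈ P, (S y p : ℝ) ^ k) ^ 2 := pow_le_pow_left₀ (by positivity) h2 2
      _ ≤ _ := h5
      _ ≤ _ := mul_le_mul h3 h4 (Finset.sum_nonneg fun n _ => sq_nonneg _) (by positivity)
  have hyk : (0:ℝ) < (y : ℝ) ^ k := by positivity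
  rcases hc0.eq_or_lt with hc1 | hc1
  · rw [← hc1]; positivity
  -- divide by `y^k * c`
  have h7 : c * ε ^ (2 * k) * y ^ k ≤ A * y * (2 * y ^ k + c * N ^ 2) := by
    have : (c * ε ^ (2 * k) * y ^ k) * (y ^ k * c) ≤ (A * y * (2 * y ^ k + c * N ^ 2)) * (y ^ k * c) := by
      calc _ = (c * (ε * y) ^ k) ^ 2 := by rw [mul_pow ε, pow_mul']; ring
        _ ≤ _ := h6
        _ = _ := by ring
    exact le_of_mul_le_mul_right this (by positivity)
  have h8 : A * y * (c * N ^ 2) ≤ c * (ε ^ (2 * k) * y ^ k / 2) := by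
    have e1 : A * y * N ^ 2 ≤ ε ^ (2 * k) * y ^ k / 2 := by
      have e2 : A * y * N ^ 2 ≤ A * y * (D * y ^ 64) := by gcongr
      have e3 : A * D * 2 ≤ ε ^ (2 * k) * y := by
        rw [div_lt_iff₀ (by positivity)] at hy0
        have : (y0 : ℝ) ≤ y := by exact_mod_cast (by omega : y0 ≤ y)
        have : (y0 : ℝ) * ε ^ (2 * k) ≤ y * ε ^ (2 * k) := by gcongr
        linarith
      have e4 : ε ^ (2 * k) * y ^ k / 2 = (ε ^ (2 * k) * y) * (y * y ^ 65) / 2 := by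
        subst hk; ring
      have e5 : (A * D * 2) * (y * y ^ 65) ≤ (ε ^ (2 * k) * y) * (y * y ^ 65) := by gcongr
      have e6 : A * D * (y ^ 65 : ℝ) ≤ ε ^ (2 * k) * y * (y * y ^ 65) / 2 := by
        rcases le_or_gt 0 D with hD | hD
        · have : A * D * (y ^ 65 : ℝ) ≤ A * D * (y * y ^ 65) := by
            have : (y ^ 65 : ℝ) ≤ y * y ^ 65 := by nlinarith [pow_pos (by linarith : (0:ℝ) < y) 65]
            gcongr
          linarith
        · have : A * D * (y ^ 65 : ℝ) ≤ 0 :=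
            mul_nonpos_of_nonpos_of_nonneg (mul_nonpos_of_nonneg_of_nonpos hA.le hD.le) (by positivity)
          exact this.trans (by positivity)
      rw [e4]
      calc _ ≤ _ := e2
        _ = A * D * (y ^ 65 : ℝ) := by ring
        _ ≤ _ := e6
    calc _ = c * (A * y * N ^ 2) := by ring
      _ ≤ _ := by gcongr
  have h9 : c * ε ^ (2 * k) * y ^ k ≤ (4 * A * y) * y ^ k := by nlinarith
  have h10 := le_of_mul_le_mul_right h9 hyk
  rw [div_mul_eq_mul_div, le_div_iff₀ (by positivity)]
  exact h10

lemma corr_sum (p : ℕ) [Fact p.Prime] (hp2 : p ≠ 2) (c d : ZMod p) (hc : c ≠ d) :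
    ∑ x : ZMod p, quadraticChar (ZMod p) (x + c) * quadraticChar (ZMod p) (x + d) = -1 := by
  set χ := quadraticChar (ZMod p) with hχ
  have hr : ringChar (ZMod p) ≠ 2 := by rw [ZMod.ringChar_zmod_n]; exact hp2
  have hJ : jacobiSum χ χ = -χ (-1) := by
    have := jacobiSum_nontrivial_inv (quadraticChar_ne_one (F := ZMod p) hr)
    rwa [(quadraticChar_isQuadratic (ZMod p)).inv] at this
  have hcd : d - c ≠ 0 := sub_ne_zero.2 hc.symm
  -- x + c = -(d-c) u
  let e : ZMod p ≃ ZMod p :=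
    { toFun := fun u => -(d - c) * u - c
      invFun := fun x => -(x + c) / (d - c)
      left_inv := fun u => by field_simp; ring
      right_inv := fun x => by field_simp; ring }
  rw [← Equiv.sum_comp e]
  have h1 : ∀ u : ZMod p, χ (e u + c) * χ (e u + d) = χ (-1) * (χ u * χ (1 - u)) := by
    intro u
    have e1 : e u + c = (-1) * (d - c) * u := by simp [e]
    have e2 : e u + d = (d - c) * (1 - u) := by simp [e]; ring
    rw [e1, e2, map_mul, map_mul, map_mul]
    have : χ (d - c) * χ (d - c) = 1 := by
      rw [← map_mul, ← sq]; exact quadraticChar_sq_one' hcd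
    calc _ = (χ (d - c) * χ (d - c)) * (χ (-1) * (χ u * χ (1 - u))) := by ring
      _ = _ := by rw [this, one_mul]
  rw [Finset.sum_congr rfl fun u _ => h1 u, ← Finset.mul_sum]
  change χ (-1) * jacobiSum χ χ = -1
  rw [hJ]
  have : χ (-1) ^ 2 = 1 := quadraticChar_sq_one (by simp)
  linarith [sq (χ (-1))]

lemma cast_injOn (p h : ℕ) (hh : h ≤ p) : Set.InjOn (fun n : ℕ => (n : ZMod p)) (Icc 1 h : Finset ℕ) := by
  intro a ha b hb hab
  simp only [coe_Icc, Set.mem_Icc] at ha hb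
  have h1 : a ≡ b [MOD p] := (ZMod.natCast_eq_natCast_iff a b p).1 hab
  have h2 : a - 1 ≡ b - 1 [MOD p] := by
    apply Nat.ModEq.add_right_cancel' 1
    rwa [Nat.sub_add_cancel ha.1, Nat.sub_add_cancel hb.1]
  have := Nat.ModEq.eq_of_lt_of_lt h2 (by omega) (by omega)
  omega

lemma bilinear (p : ℕ) [Fact p.Prime] (hp2 : p ≠ 2) (h j : ℕ) (hh : h ≤ p) (hj : j ≤ p) :
    (∑ a ∈ Icc 1 h, ∑ b ∈ Icc 1 j, quadraticChar (ZMod p) ((a : ZMod p) + b)) ^ 2 ≤ (h : ℤ) * (p * j) := by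
  set χ := quadraticChar (ZMod p) with hχ
  have h1 := Finset.sum_mul_sq_le_sq_mul_sq (Icc 1 h) (fun _ => (1:ℤ))
    (fun a => ∑ b ∈ Icc 1 j, χ ((a : ZMod p) + b))
  simp only [one_mul, one_pow, sum_const, Nat.card_Icc, Nat.add_sub_cancel, nsmul_eq_mul, mul_one] at h1
  refine h1.trans ?_
  gcongr
  calc ∑ a ∈ Icc 1 h, (∑ b ∈ Icc 1 j, χ ((a : ZMod p) + b)) ^ 2
      = ∑ x ∈ (Icc 1 h).image (fun n : ℕ => (n : ZMod p)), (∑ b ∈ Icc 1 j, χ (x + b)) ^ 2 := by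
        rw [Finset.sum_image (cast_injOn p h hh)]
    _ ≤ ∑ x : ZMod p, (∑ b ∈ Icc 1 j, χ (x + b)) ^ 2 :=
        Finset.sum_le_sum_of_subset_of_nonneg (Finset.subset_univ _) fun x _ _ => sq_nonneg _
    _ = ∑ b ∈ Icc 1 j, ∑ b' ∈ Icc 1 j, ∑ x : ZMod p, χ (x + b) * χ (x + b') := by
        simp_rw [sq, Finset.sum_mul_sum]
        rw [Finset.sum_comm]
        refine Finset.sum_congr rfl fun b _ => ?_
        rw [Finset.sum_comm]
    _ ≤ ∑ b ∈ Icc 1 j, ∑ b' ∈ Icc 1 j, if b = b' then (p : ℤ) else 0 := by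
        refine Finset.sum_le_sum fun b hb => Finset.sum_le_sum fun b' hb' => ?_
        split_ifs with hbb
        · calc _ ≤ ∑ x : ZMod p, (1:ℤ) := by
                refine Finset.sum_le_sum fun x _ => ?_
                rw [← hbb]
                rcases quadraticChar_isQuadratic (ZMod p) (x + b) with h | h | h <;> simp [hχ, h]
            _ = p := by simp [ZMod.card]
        · rw [corr_sum p hp2 b b' (fun hcon => hbb (cast_injOn p j hj hb hb' hcon))]
          norm_num
    _ = p * j := by
        simp_rw [Finset.sum_ite_eq]
        rw [Finset.sum_ite_mem, Finset.inter_self]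
        simp [mul_comm]

lemma S_diff (p : ℕ) [Fact p.Prime] (h b : ℕ) :
    ∑ a ∈ Icc 1 h, quadraticChar (ZMod p) ((a : ZMod p) + b) = S (h + b) p - S b p := by
  induction h with
  | zero => simp
  | succ h ih =>
    rw [Finset.sum_Icc_succ_top (by omega), ih]
    have : S (h + 1 + b) p = S (h + b) p + jacobiSym ((h + b + 1 : ℕ) : ℤ) p := by
      rw [show h + 1 + b = h + b + 1 by ring, S, Finset.sum_Icc_succ_top (by omega)]; rfl
    rw [this, ← jacobiSym.legendreSym.to_jacobiSym, legendreSym]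
    push_cast
    rw [show ((h : ZMod p) + b + 1) = h + 1 + b by ring]
    ring

lemma S_le (m p : ℕ) : S m p ≤ m := by
  calc S m p ≤ ∑ n ∈ Icc 1 m, 1 := Finset.sum_le_sum fun n _ => (abs_le.1 (jac_abs_le _ _)).2
    _ = m := by simp

lemma S_self (p : ℕ) (hp : p.Prime) (hp2 : p ≠ 2) : S p p = 0 := by
  have : Fact p.Prime := ⟨hp⟩
  have h := S_diff p p 0
  have h0 : S 0 p = 0 := by simp [S]
  rw [h0, sub_zero, add_zero] at h
  rw [← h]
  simp only [Nat.cast_zero, add_zero]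
  rw [← Finset.sum_image (f := fun x : ZMod p => quadraticChar (ZMod p) x) (cast_injOn p p le_rfl)]
  have : (Icc 1 p).image (fun n : ℕ => (n : ZMod p)) = Finset.univ := by
    apply Finset.eq_univ_of_card
    rw [Finset.card_image_of_injOn (cast_injOn p p le_rfl)]
    simp [ZMod.card]
  rw [this]
  exact quadraticChar_sum_zero (by rw [ZMod.ringChar_zmod_n]; exact hp2)

lemma fpt_bad (ε : ℝ) (m p : ℕ) (h : m < fpt ε p) (l : ℕ) (h1 : 1 ≤ l) (h2 : l ≤ m) :
    ε * l ≤ (S l p : ℝ) := by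
  have := Nat.notMem_of_lt_sInf (lt_of_le_of_lt h2 h)
  simp only [Set.mem_setOf_eq, not_and, not_lt] at this
  exact this h1

lemma fpt_bound (ε : ℝ) (hε : 0 < ε) (hε1 : ε ≤ 1) : ∃ K : ℝ, 0 < K ∧ ∀ p m : ℕ, p.Prime → p ≠ 2 →
    m < fpt ε p → (m : ℝ) ^ 2 ≤ K * p := by
  refine ⟨(9 / ε) ^ 2 + 144 / ε ^ 3, by positivity, fun p m hp hp2 hm => ?_⟩
  have hfact : Fact p.Prime := ⟨hp⟩
  have hbad := fpt_bad ε m p hm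
  have hmp : m < p := by
    by_contra hcon
    have h1 := hbad p hp.one_lt.le (by omega)
    rw [S_self p hp hp2] at h1
    have : (0:ℝ) < ε * p := mul_pos hε (by exact_mod_cast hp.pos)
    simp at h1
    linarith
  have hp1 : (1:ℝ) ≤ p := by exact_mod_cast hp.one_lt.le
  obtain ⟨h, hh1, hh2⟩ : ∃ h : ℕ, 2 * h ≤ m ∧ m ≤ 2 * h + 1 := ⟨m / 2, by omega, by omega⟩
  have hmR : (m : ℝ) ≤ 2 * h + 1 := by exact_mod_cast hh2
  have hm0 : (0:ℝ) ≤ m := Nat.cast_nonneg _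
  by_cases hcase : ε * h < 4
  · have e1 : (h : ℝ) < 4 / ε := by rw [lt_div_iff₀ hε]; linarith
    have e2 : (1:ℝ) ≤ 1 / ε := by rw [le_div_iff₀ hε]; linarith
    have e3 : (m : ℝ) ≤ 9 / ε := by
      have : 9 / ε = 2 * (4 / ε) + 1 / ε := by ring
      linarith
    have e4 : (m : ℝ) ^ 2 ≤ (9 / ε) ^ 2 := by gcongr
    have e5 : (0:ℝ) ≤ 144 / ε ^ 3 := by positivity
    nlinarith [sq_nonneg (9 / ε)]
  · push Not at hcase
    set j := ⌊ε * h / 2⌋₊ with hj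
    have hj1 : (j : ℝ) ≤ ε * h / 2 := Nat.floor_le (by positivity)
    have hj2 : ε * h / 2 < j + 1 := Nat.lt_floor_add_one _
    have hh0 : (0:ℝ) ≤ h := Nat.cast_nonneg _
    have hh4 : (4:ℝ) ≤ h := by nlinarith
    have hjh : j ≤ h := by
      have : (j : ℝ) ≤ h := by nlinarith
      exact_mod_cast this
    have hj4 : ε * h / 4 ≤ j := by linarith
    have hbil := bilinear p hp2 h j (by omega) (by omega)
    rw [Finset.sum_comm, Finset.sum_congr rfl fun b _ => S_diff p h b] at hbil
    have hlow : (j : ℝ) * (ε * h / 2) ≤ ((∑ b ∈ Icc 1 j, (S (h + b) p - S b p) : ℤ) : ℝ) := by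
      push_cast
      calc (j : ℝ) * (ε * h / 2) = ∑ b ∈ Icc 1 j, (ε * h / 2) := by simp
        _ ≤ _ := by
          refine Finset.sum_le_sum fun b hb => ?_
          rw [mem_Icc] at hb
          have f1 := hbad (h + b) (by omega) (by omega)
          have f2 : (S b p : ℝ) ≤ b := by exact_mod_cast S_le b p
          have f3 : (b : ℝ) ≤ j := by exact_mod_cast hb.2
          push_cast at f1
          have f4 : (0:ℝ) ≤ ε * b := by positivity
          nlinarith
    have hup : ((∑ b ∈ Icc 1 j, (S (h + b) p - S b p) : ℤ) : ℝ) ^ 2 ≤ (h : ℝ) * (p * j) := by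
      exact_mod_cast hbil
    have h5 : ((j : ℝ) * (ε * h / 2)) ^ 2 ≤ (h : ℝ) * (p * j) :=
      (pow_le_pow_left₀ (by positivity) hlow 2).trans hup
    have hjpos : (0:ℝ) < j := by linarith [mul_pos hε (by linarith : (0:ℝ) < h)]
    have h6 : (j : ℝ) * (ε ^ 2 * h / 4) ≤ p := by
      have : ((j : ℝ) * (ε ^ 2 * h / 4)) * (h * j) ≤ p * (h * j) := by
        calc _ = ((j : ℝ) * (ε * h / 2)) ^ 2 := by ring
          _ ≤ _ := h5
          _ = _ := by ring
      exact le_of_mul_le_mul_right this (by positivity)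
    have h7 : ε ^ 3 * h ^ 2 / 16 ≤ p := by
      calc ε ^ 3 * h ^ 2 / 16 = (ε * h / 4) * (ε ^ 2 * h / 4) := by ring
        _ ≤ (j : ℝ) * (ε ^ 2 * h / 4) := by gcongr
        _ ≤ p := h6
    have h8 : (m : ℝ) ≤ 3 * h := by linarith
    have h9 : (m : ℝ) ^ 2 ≤ 144 / ε ^ 3 * p := by
      calc (m : ℝ) ^ 2 ≤ (3 * h) ^ 2 := by gcongr
        _ = 144 / ε ^ 3 * (ε ^ 3 * h ^ 2 / 16) := by field_simp; ring
        _ ≤ _ := by gcongr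
    have : 0 ≤ (9 / ε) ^ 2 * (p : ℝ) := by positivity
    linarith

lemma piOdd_lb : ∃ N0 : ℕ, 2 ≤ N0 ∧ ∀ N : ℕ, N0 ≤ N → ∀ x : ℝ, ⌊x⌋₊ = N →
    (N : ℝ) / 4 ≤ (piOdd x : ℝ) * Real.log N := by
  have h1 : ∀ᶠ x : ℝ in atTop, ‖Real.log x‖ ≤ (1 / 16) * ‖x‖ :=
    Real.isLittleO_log_id_atTop.def (by norm_num)
  have h2 := tendsto_natCast_atTop_atTop (R := ℝ) |>.eventually h1
  obtain ⟨N1, hN1⟩ := eventually_atTop.1 h2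
  refine ⟨max N1 16, by omega, fun N hN x hx => ?_⟩
  have hN16 : 16 ≤ N := le_trans (le_max_right _ _) hN
  have hNr : (16 : ℝ) ≤ N := by exact_mod_cast hN16
  have hl := hN1 N (le_trans (le_max_left _ _) hN)
  have hlpos : 0 < Real.log N := Real.log_pos (by linarith)
  rw [Real.norm_of_nonneg hlpos.le, Real.norm_of_nonneg (by linarith)] at hl
  have hpi := Chebyshev.pi_ge N
  rw [div_le_iff₀ hlpos] at hpi
  have hcard : Nat.primeCounting N = piOdd x + 1 := by
    rw [piOdd, oddPrimesUpTo, hx, Nat.primeCounting, Nat.primeCounting', Nat.count_eq_card_filter_range]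
    have : (range (N + 1)).filter Nat.Prime
        = insert 2 ((range (N + 1)).filter (fun p => p.Prime ∧ p ≠ 2)) := by
      ext p
      simp only [mem_filter, mem_range, mem_insert]
      constructor
      · rintro ⟨a, b⟩
        by_cases h : p = 2
        · exact Or.inl h
        · exact Or.inr ⟨a, b, h⟩
      · rintro (h | ⟨a, b, -⟩)
        · subst h; exact ⟨by omega, Nat.prime_two⟩
        · exact ⟨a, b⟩
    rw [this, card_insert_of_notMem (by simp)]
  have hlog2 : (N:ℝ) + 1 ≤ 2 * N := by linarith
  have h3 : Real.log (N + 1) ≤ Real.log 2 + Real.log N := by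
    rw [← Real.log_mul (by norm_num) (by linarith)]
    exact Real.log_le_log (by linarith) hlog2
  have h4 := Real.log_two_gt_d9
  have h5 := Real.log_two_lt_d9
  rw [hcard] at hpi
  push_cast at hpi
  nlinarith

lemma tail_tendsto : Tendsto (fun M : ℕ => ∑' m : ℕ, if M < m then (m:ℝ)^(-(3/2):ℝ) else 0)
    atTop (nhds 0) := by
  have hs : Summable (fun m : ℕ => (m:ℝ)^(-(3/2):ℝ)) :=
    Real.summable_nat_rpow.2 (by norm_num)
  have := tendsto_tsum_of_dominated_convergence (𝓕 := atTop)
    (f := fun (M m : ℕ) => if M < m then (m:ℝ)^(-(3/2):ℝ) else 0) (g := fun _ => (0:ℝ)) hs ?_ ?_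
  · simpa using this
  · intro m
    apply tendsto_const_nhds.congr'
    filter_upwards [eventually_ge_atTop m] with M hM
    rw [if_neg (by omega)]
  · refine Eventually.of_forall fun M m => ?_
    have : 0 ≤ (m:ℝ)^(-(3/2):ℝ) := by positivity
    split_ifs
    · rw [Real.norm_of_nonneg this]
    · simpa using this

lemma h_tendsto : Tendsto (fun N : ℝ => N^(-(1/4):ℝ) * Real.log N) atTop (nhds 0) := by
  have := (isLittleO_log_rpow_atTop (r := 1/4) (by norm_num)).tendsto_div_nhds_zero
  refine this.congr' ?_
  filter_upwards [eventually_gt_atTop 0] with x hx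
  rw [Real.rpow_neg hx.le]; field_simp

/-- choice of `y`. -/
lemma y_choice (N : ℕ) (hN : 2 ^ 32 ≤ N) : ∃ y : ℕ, 2 ≤ y ∧ y ^ 32 ≤ N ∧ N < (y + 1) ^ 32 := by
  have hex : ∃ k : ℕ, N < (k + 1) ^ 32 :=
    ⟨N, lt_of_lt_of_le (Nat.lt_succ_self N) (Nat.le_self_pow (by norm_num) _)⟩
  classical
  refine ⟨Nat.find hex, ?_, ?_, Nat.find_spec hex⟩
  · by_contra h
    have h1 := Nat.find_spec hex
    have : (Nat.find hex + 1) ^ 32 ≤ 2 ^ 32 := Nat.pow_le_pow_left (by omega) _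
    omega
  · by_contra h
    rcases Nat.eq_zero_or_pos (Nat.find hex) with h0 | h0
    · rw [h0] at h; simp at h
    · have := Nat.find_min hex (m := Nat.find hex - 1) (by omega)
      rw [Nat.sub_add_cancel h0] at this
      omega

set_option maxHeartbeats 2000000 in
lemma main_bound (ε : ℝ) (hε : 0 < ε) (hε1 : ε ≤ 1) : ∃ C1 C2 : ℝ, ∃ N0 : ℕ, ∀ N : ℕ, N0 ≤ N →
    ∀ x : ℝ, ⌊x⌋₊ = N → ∀ M : ℕ,
    ∑' m : ℕ, (if M < m then aCoef ε m x else 0)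
      ≤ C1 * (∑' m : ℕ, if M < m then (m:ℝ)^(-(3/2):ℝ) else 0)
        + C2 * ((N:ℝ)^(-(1/4):ℝ) * Real.log N) := by
  obtain ⟨C, hC, hsm⟩ := bad_small ε hε
  obtain ⟨D, hD, y0, hlg⟩ := bad_large ε hε (2 ^ 64)
  obtain ⟨K, hK, hfb⟩ := fpt_bound ε hε hε1
  obtain ⟨N1, -, hpi⟩ := piOdd_lb
  refine ⟨512 * C, 4 * (1 + 2 * C) + 4 * D * Real.sqrt K, max N1 ((y0 + 2) ^ 32), ?_⟩
  intro N hN x hx M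
  have hNy : (y0 + 2) ^ 32 ≤ N := le_trans (le_max_right _ _) hN
  have hN2 : 2 ^ 32 ≤ N := le_trans (Nat.pow_le_pow_left (by omega) _) hNy
  obtain ⟨y, hy2, hy1, hy3⟩ := y_choice N hN2
  have hyy : y0 ≤ y := by
    have := lt_of_le_of_lt hNy hy3
    have := lt_of_pow_lt_pow_left₀ 32 (by omega) this
    omega
  have hpi' := hpi N (le_trans (le_max_left _ _) hN) x hx
  have hNpos : (0:ℝ) < N := by
    have : 0 < N := by omega
    exact_mod_cast this
  have hN1 : (1:ℝ) < N := by
    have : 1 < N := by omega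
    exact_mod_cast this
  have hy2r : (2:ℝ) ≤ y := by exact_mod_cast hy2
  have hD64 : (N:ℝ)^2 ≤ 2 ^ 64 * (y:ℝ)^64 := by
    have h1 : (N:ℝ) < ((y:ℝ) + 1) ^ 32 := by exact_mod_cast hy3
    calc (N:ℝ)^2 ≤ ((2 * (y:ℝ)) ^ 32) ^ 2 := by
          refine pow_le_pow_left₀ hNpos.le (h1.le.trans (pow_le_pow_left₀ (by linarith only [hy2r]) (by linarith only [hy2r]) _)) _
      _ = 2 ^ 64 * (y:ℝ)^64 := by rw [← pow_mul, mul_pow]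
  have hy1r : (y:ℝ) ^ 32 ≤ N := by exact_mod_cast hy1
  have hy3r : (N:ℝ) ≤ (2 * y) ^ 32 := by
    have h1 : (N:ℝ) < ((y:ℝ) + 1) ^ 32 := by exact_mod_cast hy3
    exact h1.le.trans (pow_le_pow_left₀ (by linarith) (by linarith) _)
  have hlN : 0 < Real.log N := Real.log_pos hN1
  have hly : 0 < Real.log y := Real.log_pos (by linarith)
  have hNlog : Real.log N ≤ 64 * Real.log y := by
    have h1 : (N:ℝ) ≤ (y:ℝ) ^ 64 := by
      refine hy3r.trans ?_
      have : (2 * y : ℝ) ≤ y ^ 2 := by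
        rw [pow_two]; exact mul_le_mul_of_nonneg_right hy2r (by positivity)
      calc (2 * y : ℝ) ^ 32 ≤ (y ^ 2) ^ 32 := pow_le_pow_left₀ (by linarith) this _
        _ = y ^ 64 := by ring
    have h2 := Real.log_le_log hNpos h1
    rw [Real.log_pow] at h2
    exact_mod_cast h2
  clear hNy hN2 hy3 hy3r hN hpi
  have hyN : (y:ℝ) ≤ (N:ℝ)^((1/32):ℝ) := by
    rw [show (1/32:ℝ) = ((32:ℕ):ℝ)⁻¹ by norm_num]
    rw [Real.le_rpow_inv_iff_of_pos (by positivity) (by positivity) (by norm_num)]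
    rw [Real.rpow_natCast]; exact hy1r
  clear hy1 hy1r
  have hlg' := hlg y N hyy hD64
  clear hlg hD64
  have hpip : (0:ℝ) < piOdd x := by
    by_contra h
    have : (piOdd x : ℝ) * Real.log N ≤ 0 := mul_nonpos_of_nonpos_of_nonneg (not_lt.1 h) hlN.le
    linarith
  set q : ℝ := Real.log N / N with hq
  have hqpos : 0 < q := by positivity
  have hinv : ∀ c : ℝ, 0 ≤ c → c / piOdd x ≤ 4 * q * c := by
    intro c hc
    rw [div_le_iff₀ hpip, hq]
    have : 1 ≤ 4 * (Real.log N / N) * piOdd x := by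
      rw [show 4 * (Real.log N / N) * piOdd x = (4 * (piOdd x * Real.log N)) / N by ring,
        le_div_iff₀ hNpos]
      linarith
    have h2 := mul_le_mul_of_nonneg_right this hc
    rw [one_mul] at h2
    exact h2.trans (le_of_eq (by ring))
  have hodd : oddPrimesUpTo x = (range (N+1)).filter (fun p => p.Prime ∧ p ≠ 2) := by
    rw [oddPrimesUpTo, hx]
  have hsub : ∀ m l : ℕ, 1 ≤ l → l ≤ m →
      (((oddPrimesUpTo x).filter (fun p => m < fpt ε p)).card : ℝ) ≤ ((Bad ε l N).card : ℝ) := by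
    intro m l hl hlm
    have : (oddPrimesUpTo x).filter (fun p => m < fpt ε p) ⊆ Bad ε l N := by
      rw [hodd, Bad]
      intro p hp
      rw [mem_filter] at hp ⊢
      exact ⟨hp.1, fpt_bad ε m p hp.2 l hl hlm⟩
    exact_mod_cast card_le_card this
  set R : ℕ := ⌊Real.sqrt (K * N)⌋₊ with hR
  have hzero : ∀ m : ℕ, R < m → aCoef ε m x = 0 := by
    intro m hm
    have : (oddPrimesUpTo x).filter (fun p => m < fpt ε p) = ∅ := by
      rw [filter_eq_empty_iff]
      intro p hp hmp
      rw [hodd, mem_filter, mem_range] at hp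
      have h1 := hfb p m hp.2.1 hp.2.2 hmp
      have hpN : (p:ℝ) ≤ N := by
        have : p ≤ N := by omega
        exact_mod_cast this
      have h2 : (m:ℝ) ≤ Real.sqrt (K * N) :=
        Real.le_sqrt_of_sq_le (h1.trans (by gcongr))
      have := Nat.le_floor h2
      omega
    rw [aCoef, this]; simp
  have ha1 : ∀ m : ℕ, 1 ≤ m → m ≤ y →
      aCoef ε m x ≤ 512 * C * (m:ℝ)^(-(3/2):ℝ) + 4 * (1 + 2 * C) * (y:ℝ)^8 * q := by
    intro m hm hmy
    have hb := (hsub m m hm le_rfl).trans (hsm m N y hm hy2)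
    have hmr : (1:ℝ) ≤ m := by exact_mod_cast hm
    have hmyr : (m:ℝ) ≤ y := by exact_mod_cast hmy
    set w : ℝ := (m:ℝ)^(-(3/2):ℝ) with hw
    have hw0 : 0 ≤ w := by positivity
    have hw1 : w ≤ 1 := Real.rpow_le_one_of_one_le_of_nonpos hmr (by norm_num)
    have h1 : 2 * N / Real.log y ≤ 128 * (N / Real.log N) := by
      rw [div_le_iff₀ hly]
      rw [show 128 * ((N:ℝ) / Real.log N) * Real.log y
        = 2 * N * ((64 * Real.log y) / Real.log N) by ring]
      have : 1 ≤ (64 * Real.log y) / Real.log N := by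
        rw [le_div_iff₀ hlN, one_mul]; exact hNlog
      exact le_mul_of_one_le_right (by positivity) this
    have hy4 : (m:ℝ)^4 ≤ (y:ℝ)^4 := by gcongr
    have h8 : (y:ℝ) ≤ (y:ℝ)^8 := le_self_pow₀ (by linarith) (by norm_num)
    have h48 : (y:ℝ)^4 ≤ (y:ℝ)^8 := pow_le_pow_right₀ (by linarith) (by norm_num)
    have h44 : (y:ℝ)^4 * (m:ℝ)^4 ≤ (y:ℝ)^8 := by
      calc (y:ℝ)^4 * (m:ℝ)^4 ≤ (y:ℝ)^4 * (y:ℝ)^4 := by gcongr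
        _ = (y:ℝ)^8 := by ring
    have h5 : w * (2 * N / Real.log y + (y:ℝ)^4) ≤ w * (128 * (N / Real.log N)) + (y:ℝ)^8 := by
      have e1 : w * (2 * N / Real.log y) ≤ w * (128 * (N / Real.log N)) := by gcongr
      have e2 : w * (y:ℝ)^4 ≤ 1 * (y:ℝ)^8 := by gcongr
      linarith
    have h6 : (((oddPrimesUpTo x).filter (fun p => m < fpt ε p)).card : ℝ) ≤
        C * (w * (128 * (N / Real.log N))) + (1 + 2 * C) * (y:ℝ)^8 := by
      refine hb.trans ?_
      have := mul_le_mul_of_nonneg_left (add_le_add h5 h44) hC.le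
      linarith
    rw [aCoef]
    refine (hinv _ (by positivity)).trans ?_
    refine (mul_le_mul_of_nonneg_left h6 (by positivity)).trans (le_of_eq ?_)
    rw [hq]; field_simp; ring
  have ha2 : ∀ m : ℕ, y < m → aCoef ε m x ≤ 4 * q * (D * y) := by
    intro m hm
    have hb := (hsub m y (by omega) hm.le).trans hlg'
    rw [aCoef]
    exact (hinv _ (by positivity)).trans (mul_le_mul_of_nonneg_left hb (by positivity))
  have hs : Summable (fun m : ℕ => (m:ℝ)^(-(3/2):ℝ)) :=
    Real.summable_nat_rpow.2 (by norm_num)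
  have hs' : Summable (fun m : ℕ => if M < m then (m:ℝ)^(-(3/2):ℝ) else 0) := by
    refine Summable.of_nonneg_of_le (fun m => ?_) (fun m => ?_) hs
    · split_ifs <;> positivity
    · split_ifs
      · exact le_rfl
      · positivity
  set c1 : ℝ := 4 * (1 + 2 * C) * (y:ℝ)^8 * q with hc1
  set c2 : ℝ := 4 * q * (D * y) with hc2
  have hc1p : 0 ≤ c1 := by positivity
  have hc2p : 0 ≤ c2 := by positivity
  have hpt : ∀ m : ℕ, (if M < m then aCoef ε m x else 0) ≤
      512 * C * (if M < m then (m:ℝ)^(-(3/2):ℝ) else 0)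
        + ((if m ∈ Icc 1 y then c1 else 0) + (if m ∈ Icc 1 R then c2 else 0)) := by
    intro m
    by_cases hMm : M < m
    · rw [if_pos hMm, if_pos hMm]
      have hm1 : 1 ≤ m := by omega
      by_cases hmy : m ≤ y
      · rw [if_pos (mem_Icc.2 ⟨hm1, hmy⟩)]
        have := ha1 m hm1 hmy
        have h0 : 0 ≤ (if m ∈ Icc 1 R then c2 else 0) := by split_ifs <;> simp [hc2p]
        linarith
      · have h1 : 0 ≤ (if m ∈ Icc 1 y then c1 else 0) := by split_ifs <;> simp [hc1p]
        have h2 : 0 ≤ 512 * C * (m:ℝ)^(-(3/2):ℝ) := by positivity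
        by_cases hmR : m ≤ R
        · rw [if_pos (mem_Icc.2 ⟨hm1, hmR⟩)]
          have := ha2 m (by omega)
          linarith
        · rw [hzero m (by omega)]
          have h0 : 0 ≤ (if m ∈ Icc 1 R then c2 else 0) := by split_ifs <;> simp [hc2p]
          linarith
    · rw [if_neg hMm, if_neg hMm]
      have h0 : 0 ≤ (if m ∈ Icc 1 R then c2 else 0) := by split_ifs <;> simp [hc2p]
      have h1 : 0 ≤ (if m ∈ Icc 1 y then c1 else 0) := by split_ifs <;> simp [hc1p]
      linarith
  have hconst : ∀ (B Q : ℕ) (c : ℝ), 0 ≤ c →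
      ∑ m ∈ range B, (if m ∈ Icc 1 Q then c else 0) ≤ Q * c := by
    intro B Q c hc
    rw [← sum_filter, sum_const, nsmul_eq_mul]
    have : ((range B).filter (fun m => m ∈ Icc 1 Q)).card ≤ Q := by
      calc _ ≤ (Icc 1 Q).card := card_le_card (fun m hm => (mem_filter.1 hm).2)
        _ = Q := by simp
    have : ((((range B).filter (fun m => m ∈ Icc 1 Q)).card : ℕ) : ℝ) ≤ Q := by exact_mod_cast this
    gcongr
  rw [tsum_eq_sum (s := range (R + 1)) (fun m hm => by
    rw [mem_range] at hm
    rw [hzero m (by omega)]; simp)]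
  refine (sum_le_sum (fun m _ => hpt m)).trans ?_
  rw [sum_add_distrib, sum_add_distrib, ← mul_sum]
  have t1 : ∑ m ∈ range (R+1), (if M < m then (m:ℝ)^(-(3/2):ℝ) else 0)
      ≤ ∑' m : ℕ, (if M < m then (m:ℝ)^(-(3/2):ℝ) else 0) :=
    hs'.sum_le_tsum _ (fun m _ => by split_ifs <;> positivity)
  have t2 := hconst (R+1) y c1 hc1p
  have t3 := hconst (R+1) R c2 hc2p
  have hqN : (N:ℝ)^((3/4):ℝ) * q = (N:ℝ)^(-(1/4):ℝ) * Real.log N := by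
    rw [hq, show (-(1/4):ℝ) = 3/4 - 1 by norm_num, Real.rpow_sub hNpos, Real.rpow_one]
    ring
  have hy9 : (y:ℝ)^9 ≤ (N:ℝ)^((3/4):ℝ) := by
    calc (y:ℝ)^9 ≤ ((N:ℝ)^((1/32):ℝ))^9 := by gcongr
      _ = (N:ℝ)^((9/32):ℝ) := by
        rw [← Real.rpow_natCast, ← Real.rpow_mul hNpos.le]; norm_num
      _ ≤ _ := Real.rpow_le_rpow_of_exponent_le hN1.le (by norm_num)
  have hRy : (R:ℝ) * y ≤ Real.sqrt K * (N:ℝ)^((3/4):ℝ) := by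
    have hRle : (R:ℝ) ≤ Real.sqrt (K * N) := Nat.floor_le (Real.sqrt_nonneg _)
    rw [Real.sqrt_mul hK.le, Real.sqrt_eq_rpow (N:ℝ)] at hRle
    calc (R:ℝ) * y ≤ (Real.sqrt K * (N:ℝ)^((1/2):ℝ)) * (N:ℝ)^((1/32):ℝ) := by gcongr
      _ = Real.sqrt K * (N:ℝ)^((17/32):ℝ) := by
        rw [mul_assoc, ← Real.rpow_add hNpos]; norm_num
      _ ≤ _ := mul_le_mul_of_nonneg_left
        (Real.rpow_le_rpow_of_exponent_le hN1.le (by norm_num)) (Real.sqrt_nonneg K)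
  rw [← hqN]
  have f1 : y * c1 ≤ 4 * (1 + 2 * C) * ((N:ℝ)^((3/4):ℝ) * q) := by
    calc y * c1 = 4 * (1 + 2 * C) * ((y:ℝ)^9 * q) := by rw [hc1]; ring
      _ ≤ _ := by gcongr
  have f2 : R * c2 ≤ 4 * D * Real.sqrt K * ((N:ℝ)^((3/4):ℝ) * q) := by
    calc R * c2 = 4 * D * ((R * y) * q) := by rw [hc2]; ring
      _ ≤ 4 * D * ((Real.sqrt K * (N:ℝ)^((3/4):ℝ)) * q) := by gcongr
      _ = _ := by ring
  have f3 := mul_le_mul_of_nonneg_left t1 (show 0 ≤ 512 * C by positivity)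
  linarith

/-- For fixed `ε ∈ (0,1]`: `lim_{M→∞} limsup_{x→∞} ∑_{m > M} a_m(x) = 0`. -/
theorem stmt11 (ε : ℝ) (hε : 0 < ε) (hε1 : ε ≤ 1) :
    Filter.Tendsto (fun M : ℕ =>
        Filter.limsup (fun x : ℝ => ∑' m : ℕ, if M < m then aCoef ε m x else 0)
          Filter.atTop)
      Filter.atTop (nhds 0) := by
  obtain ⟨C1, C2, N0, hmain⟩ := main_bound ε hε hε1
  have hnn : ∀ (M : ℕ) (x : ℝ), 0 ≤ ∑' m : ℕ, (if M < m then aCoef ε m x else 0) := by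
    intro M x
    refine tsum_nonneg fun m => ?_
    split_ifs
    · unfold aCoef; positivity
    · exact le_rfl
  have hh : Tendsto (fun x : ℝ => ((⌊x⌋₊ : ℕ) : ℝ)^(-(1/4):ℝ) * Real.log (⌊x⌋₊ : ℕ)) atTop (nhds 0) :=
    (h_tendsto.comp tendsto_natCast_atTop_atTop).comp tendsto_nat_floor_atTop
  have hT : ∀ M : ℕ, Tendsto (fun x : ℝ => C1 * (∑' m : ℕ, if M < m then (m:ℝ)^(-(3/2):ℝ) else 0)
      + C2 * (((⌊x⌋₊ : ℕ) : ℝ)^(-(1/4):ℝ) * Real.log (⌊x⌋₊ : ℕ))) atTop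
      (nhds (C1 * (∑' m : ℕ, if M < m then (m:ℝ)^(-(3/2):ℝ) else 0))) := by
    intro M
    simpa using tendsto_const_nhds.add (hh.const_mul C2)
  have hle : ∀ M : ℕ, ∀ᶠ x : ℝ in atTop, ∑' m : ℕ, (if M < m then aCoef ε m x else 0) ≤
      C1 * (∑' m : ℕ, if M < m then (m:ℝ)^(-(3/2):ℝ) else 0)
      + C2 * (((⌊x⌋₊ : ℕ) : ℝ)^(-(1/4):ℝ) * Real.log (⌊x⌋₊ : ℕ)) := by
    intro M
    filter_upwards [tendsto_nat_floor_atTop.eventually_ge_atTop N0] with x hx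
    exact hmain _ hx x rfl M
  have hcob : ∀ M : ℕ, IsCoboundedUnder (· ≤ ·) atTop
      (fun x : ℝ => ∑' m : ℕ, if M < m then aCoef ε m x else 0) := fun M =>
    (isBoundedUnder_of ⟨0, fun x => hnn M x⟩ : IsBoundedUnder (· ≥ ·) atTop _).isCoboundedUnder_le
  refine squeeze_zero (g := fun M : ℕ => C1 * (∑' m : ℕ, if M < m then (m:ℝ)^(-(3/2):ℝ) else 0))
    (fun M => ?_) (fun M => ?_) (by simpa using tail_tendsto.const_mul C1)
  · refine le_limsup_of_frequently_le (Eventually.of_forall fun x => hnn M x).frequently ?_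
    exact (hT M).isBoundedUnder_le.mono_le (hle M)
  · rw [← (hT M).limsup_eq]
    exact limsup_le_limsup (hle M) (hcob M) (hT M).isBoundedUnder_le

end
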